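/- arXiv:1901.01591 — 4 statements merged into one kernel-verified Lean document; each statement's English description precedes it below -/
import Mathlib

section
/- For every k ≥ 1, the following identity of formal power series in z with coefficients in ℤ[x_1,…,x_k,t] holds: D(x,t,z) · Σ_{n≥1} W_n^<(x,t) z^n = Σ_{i≥2} a_i(t) e_i(x) z^i, where a_i(t) := Σ_{j=0}^{i−2} (j+1) t^j and W_n^<(x,t) := Σ_w t^{des(w)} x_w, the sum over all Smirnov words w of length n over [k] with w_1 < w_n. -/
open Finset MvPolynomial Polynomial

attribute [local instance] Classical.propDecidable

noncomputable section

/-- The descent number of a word `w = w₁⋯wₙ` over the alphabet `[k]`: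
the number of indices `i ∈ [n-1]` with `wᵢ > wᵢ₊₁`. -/
def desc {n k : ℕ} (w : Fin n → Fin k) : ℕ :=
  (Finset.univ.filter fun i : Fin n =>
    ∃ h : (i : ℕ) + 1 < n, w ⟨(i : ℕ) + 1, h⟩ < w i).card

/-- The cyclic descent number: the number of indices `i ∈ [n]` with `wᵢ > wᵢ₊₁`,
where `wₙ₊₁ := w₁`. -/
def cdesc {n k : ℕ} (w : Fin n → Fin k) : ℕ :=
  (Finset.univ.filter fun i : Fin n =>
    w ⟨((i : ℕ) + 1) % n, Nat.mod_lt _ i.pos⟩ < w i).card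

/-- A word is Smirnov if no two adjacent letters are equal. -/
def IsSmirnov {n k : ℕ} (w : Fin n → Fin k) : Prop :=
  ∀ i : Fin n, ∀ h : (i : ℕ) + 1 < n, w ⟨(i : ℕ) + 1, h⟩ ≠ w i

/-- the first letter is strictly smaller than the last letter -/
def FirstLtLast {n k : ℕ} (w : Fin n → Fin k) : Prop :=
  ∃ h : 0 < n, w ⟨0, h⟩ < w ⟨n - 1, Nat.sub_lt h Nat.one_pos⟩

/-- the first letter is strictly larger than the last letter -/
def FirstGtLast {n k : ℕ} (w : Fin n → Fin k) : Prop :=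
  ∃ h : 0 < n, w ⟨n - 1, Nat.sub_lt h Nat.one_pos⟩ < w ⟨0, h⟩

/-- the first letter equals the last letter -/
def FirstEqLast {n k : ℕ} (w : Fin n → Fin k) : Prop :=
  ∃ h : 0 < n, w ⟨0, h⟩ = w ⟨n - 1, Nat.sub_lt h Nat.one_pos⟩

/-- the first letter differs from the last letter -/
def FirstNeLast {n k : ℕ} (w : Fin n → Fin k) : Prop :=
  ∃ h : 0 < n, w ⟨0, h⟩ ≠ w ⟨n - 1, Nat.sub_lt h Nat.one_pos⟩

/-- the monomial `x_w = x_{w₁}⋯x_{wₙ}` -/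
def xw (R : Type) [CommRing R] {n k : ℕ} (w : Fin n → Fin k) : MvPolynomial (Fin k) R :=
  ∏ i, MvPolynomial.X (w i)

/-- Generic restricted Smirnov word enumerator: the sum of `t^(stat w) · x_w` over all
Smirnov words `w` of length `n` over `[k]` satisfying `P`, as a polynomial in `t`
with coefficients in `R[x₁,…,x_k]`. -/
def smirnovEnum (R : Type) [CommRing R] (n k : ℕ) (stat : (Fin n → Fin k) → ℕ)
    (P : (Fin n → Fin k) → Prop) : Polynomial (MvPolynomial (Fin k) R) :=
  ∑ w ∈ Finset.univ.filter (fun w : Fin n → Fin k => IsSmirnov w ∧ P w),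
    Polynomial.X ^ stat w * Polynomial.C (xw R w)

/-- the t-analogue `[m]_t = 1 + t + ⋯ + t^(m-1)`, as a polynomial in `t = Polynomial.X`
with coefficients in `R[x₁,…,x_k]` -/
def tnum (R : Type) [CommRing R] (k m : ℕ) : Polynomial (MvPolynomial (Fin k) R) :=
  ∑ j ∈ Finset.range m, Polynomial.X ^ j

/-- `D(x,t,z) = 1 - Σ_{i≥2} t[i-1]_t e_i(x) z^i`, a formal power series in `z` whose
coefficients are polynomials in `t` with coefficients in `R[x₁,…,x_k]`. -/
def Dser (R : Type) [CommRing R] (k : ℕ) : PowerSeries (Polynomial (MvPolynomial (Fin k) R)) :=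
  PowerSeries.mk fun i =>
    if i = 0 then 1
    else if i = 1 then 0
    else -(Polynomial.X * tnum R k (i - 1) * Polynomial.C (esymm (Fin k) R i))


/-- transfer weight -/
def swt (k : ℕ) (a c : Fin k) : Polynomial (MvPolynomial (Fin k) ℤ) :=
  if a < c then 1 else if c < a then Polynomial.X else 0

/-- weight of a word -/
def swordWt (k n : ℕ) (w : Fin (n + 1) → Fin k) : Polynomial (MvPolynomial (Fin k) ℤ) :=
  (∏ i : Fin n, swt k (w i.castSucc) (w i.succ)) * ∏ i, Polynomial.C (MvPolynomial.X (w i))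

lemma sword_desc {k n : ℕ} (w : Fin (n + 1) → Fin k) :
    desc w = ∑ i : Fin n, if w i.succ < w i.castSucc then 1 else 0 := by
  unfold desc
  rw [Finset.card_filter, Fin.sum_univ_castSucc]
  have h0 : ¬ (∃ h : ((Fin.last n : Fin (n + 1)) : ℕ) + 1 < n + 1,
      w ⟨((Fin.last n : Fin (n + 1)) : ℕ) + 1, h⟩ < w (Fin.last n)) := by
    rintro ⟨h, -⟩
    simp at h
  rw [if_neg h0, add_zero]
  refine Finset.sum_congr rfl fun i _ => ?_
  congr 1
  apply propext
  constructor
  · rintro ⟨h, h'⟩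
    exact h'
  · intro h'
    exact ⟨by simp, h'⟩

lemma sword_smirnov {k n : ℕ} (w : Fin (n + 1) → Fin k) :
    IsSmirnov w ↔ ∀ i : Fin n, w i.succ ≠ w i.castSucc := by
  constructor
  · intro h i
    exact h i.castSucc (by simp)
  · intro h i hi
    exact h ⟨i, by omega⟩

lemma swordWt_eq {k n : ℕ} (w : Fin (n + 1) → Fin k) :
    swordWt k n w =
      if IsSmirnov w then Polynomial.X ^ desc w * Polynomial.C (xw ℤ w) else 0 := by
  unfold swordWt xw
  rw [map_prod]
  split_ifs with h
  · congr 1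
    rw [sword_desc, ← Finset.prod_pow_eq_pow_sum]
    rw [sword_smirnov] at h
    refine Finset.prod_congr rfl fun i _ => ?_
    have := h i
    unfold swt
    rcases lt_trichotomy (w i.castSucc) (w i.succ) with h1 | h1 | h1
    · simp [h1, h1.not_gt]
    · exact absurd h1.symm this
    · simp [h1, h1.not_gt]
  · rw [sword_smirnov] at h
    push Not at h
    obtain ⟨i, hi⟩ := h
    rw [Finset.prod_eq_zero (Finset.mem_univ i), zero_mul]
    simp [swt, hi]

/-- sum over the words with given ends -/
def sendSum (k n : ℕ) (b a : Fin k) : Polynomial (MvPolynomial (Fin k) ℤ) :=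
  ∑ w : Fin (n + 1) → Fin k, if w 0 = a ∧ w (Fin.last n) = b then swordWt k n w else 0

lemma sendSum_zero (k : ℕ) (b a : Fin k) :
    sendSum k 0 b a = if a = b then Polynomial.C (MvPolynomial.X b) else 0 := by
  unfold sendSum
  rw [← (Equiv.funUnique (Fin 1) (Fin k)).symm.sum_comp]
  simp only [swordWt, Equiv.funUnique_symm_apply, uniqueElim_const]
  split_ifs with h
  · subst h
    simp
  · apply Finset.sum_eq_zero
    intro c _
    rw [if_neg]
    rintro ⟨rfl, rfl⟩
    exact h rfl

lemma sendSum_succ (k n : ℕ) (b a : Fin k) :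
    sendSum k (n + 1) b a =
      Polynomial.C (MvPolynomial.X a) * ∑ c, swt k a c * sendSum k n b c := by
  unfold sendSum
  rw [← (Fin.consEquiv (fun _ : Fin (n + 2) => Fin k)).sum_comp, Fintype.sum_prod_type]
  rw [Finset.sum_eq_single a]
  · simp_rw [Finset.mul_sum]
    rw [Finset.sum_comm]
    refine Finset.sum_congr rfl fun w _ => ?_
    rw [Finset.sum_eq_single (w 0)]
    · have hl : (Fin.cons a w : Fin (n + 2) → Fin k) (Fin.last (n + 1)) = w (Fin.last n) := by
        rw [← Fin.succ_last, Fin.cons_succ]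
      simp only [Fin.consEquiv, Equiv.coe_fn_mk, Fin.cons_zero, hl, true_and]
      split_ifs
      · unfold swordWt
        rw [Fin.prod_univ_succ, Fin.prod_univ_succ (n := n + 1)]
        simp only [Fin.castSucc_zero, Fin.cons_zero, Fin.cons_succ, ← Fin.succ_castSucc]
        ring
      · simp
    · intro c _ hc
      rw [if_neg]
      · simp
      · rintro ⟨h, -⟩
        exact hc h.symm
    · simp
  · intro c _ hc
    apply Finset.sum_eq_zero
    intro w _
    rw [if_neg]
    rintro ⟨h, -⟩
    exact hc h
  · simp

lemma smirnovEnum_succ (k n : ℕ) :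
    smirnovEnum ℤ (n + 1) k desc FirstLtLast =
      ∑ b, ∑ a, if a < b then sendSum k n b a else 0 := by
  have h1 : ∀ b a : Fin k, (if a < b then sendSum k n b a else 0) =
      ∑ w : Fin (n + 1) → Fin k,
        if w (Fin.last n) = b then (if w 0 = a then
          (if w 0 < w (Fin.last n) then swordWt k n w else 0) else 0) else 0 := by
    intro b a
    unfold sendSum
    by_cases hab : a < b
    · rw [if_pos hab]
      refine Finset.sum_congr rfl fun w _ => ?_
      by_cases h1 : w 0 = a <;> by_cases h2 : w (Fin.last n) = b <;> simp [h1, h2, hab]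
    · rw [if_neg hab]
      symm
      apply Finset.sum_eq_zero
      intro w _
      by_cases h1 : w 0 = a <;> by_cases h2 : w (Fin.last n) = b <;> simp [h1, h2, hab]
  simp_rw [h1]
  have h2 : ∀ b : Fin k, (∑ a, ∑ w : Fin (n + 1) → Fin k,
        if w (Fin.last n) = b then (if w 0 = a then
          (if w 0 < w (Fin.last n) then swordWt k n w else 0) else 0) else 0) =
      ∑ w : Fin (n + 1) → Fin k, if w (Fin.last n) = b then
          (if w 0 < w (Fin.last n) then swordWt k n w else 0) else 0 := by
    intro b
    rw [Finset.sum_comm]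
    refine Finset.sum_congr rfl fun w _ => ?_
    split_ifs <;> simp
  simp_rw [h2]
  rw [Finset.sum_comm]
  unfold smirnovEnum
  rw [Finset.sum_filter]
  refine Finset.sum_congr rfl fun w _ => ?_
  rw [Finset.sum_ite_eq, if_pos (Finset.mem_univ _), swordWt_eq]
  have h3 : FirstLtLast w ↔ w 0 < w (Fin.last n) := by
    constructor
    · rintro ⟨_, h⟩
      exact h
    · intro h
      exact ⟨by omega, h⟩
  rw [h3]
  by_cases h4 : IsSmirnov w <;> by_cases h5 : w 0 < w (Fin.last n) <;> simp [h4, h5]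

section abstractPart
variable {R : Type*} [CommRing R]

lemma tele (t S : R) (y s d : ℕ → R) (k : ℕ) 
    (h : ∀ a < k, s (a + 1) * (1 + y a) = s a * (1 + t * y a) + y a * S + d a) (h0 : s 0 = 0) :
    ∀ m ≤ k, (1 - t) * (s m * ∏ c ∈ range m, (1 + y c)) =
      S * (∏ c ∈ range m, (1 + y c) - ∏ c ∈ range m, (1 + t * y c)) +
      (1 - t) * ∑ a ∈ range m, d a * (∏ c ∈ range a, (1 + y c)) *
        ∏ c ∈ Ico (a + 1) m, (1 + t * y c) := by
  intro m
  induction m with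
  | zero => simp [h0]
  | succ m ih =>
    intro hm
    have ih := ih (by omega)
    have h1 := h m (by omega)
    rw [Finset.prod_range_succ, Finset.prod_range_succ, Finset.sum_range_succ]
    have h2 : ∑ a ∈ range m, d a * (∏ c ∈ range a, (1 + y c)) *
        ∏ c ∈ Ico (a + 1) (m + 1), (1 + t * y c) = (∑ a ∈ range m, d a *
        (∏ c ∈ range a, (1 + y c)) * ∏ c ∈ Ico (a + 1) m, (1 + t * y c)) * (1 + t * y m) := by
      rw [Finset.sum_mul]
      refine Finset.sum_congr rfl fun a ha => ?_
      rw [Finset.prod_Ico_succ_top (by simpa using ha)]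
      ring
    rw [h2, Finset.Ico_self, Finset.prod_empty]
    linear_combination (1 + t * y m) * ih + (1 - t) * (∏ c ∈ range m, (1 + y c)) * h1

/-- y-telescoping -/
lemma tele2 (t : R) (y : ℕ → R) (k : ℕ) :
    (1 - t) * ∑ b ∈ range k, y b * (∏ c ∈ range b, (1 + y c)) *
        ∏ c ∈ Ico (b + 1) k, (1 + t * y c) =
      ∏ c ∈ range k, (1 + y c) - ∏ c ∈ range k, (1 + t * y c) := by
  induction k with
  | zero => simp
  | succ k ih =>
    rw [Finset.prod_range_succ, Finset.prod_range_succ, Finset.sum_range_succ]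
    have h2 : ∑ a ∈ range k, y a * (∏ c ∈ range a, (1 + y c)) *
        ∏ c ∈ Ico (a + 1) (k + 1), (1 + t * y c) = (∑ a ∈ range k, y a *
        (∏ c ∈ range a, (1 + y c)) * ∏ c ∈ Ico (a + 1) k, (1 + t * y c)) * (1 + t * y k) := by
      rw [Finset.sum_mul]
      refine Finset.sum_congr rfl fun a ha => ?_
      rw [Finset.prod_Ico_succ_top (by simpa using ha)]
      ring
    rw [h2, Finset.Ico_self, Finset.prod_empty]
    linear_combination (1 + t * y k) * ih

lemma absOne [IsDomain R] (t : R) (y f : ℕ → R) (k b : ℕ) (hb : b < k) (ht : 1 - t ≠ 0)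
    (hy : ∀ c, 1 + y c ≠ 0)
    (h : ∀ a < k, f a = y a * (∑ c ∈ Ico (a + 1) k, f c + t * ∑ c ∈ range a, f c) +
      if a = b then y b else 0) :
    (∏ c ∈ range k, (1 + t * y c) - t * ∏ c ∈ range k, (1 + y c)) * ∑ a ∈ range b, f a =
      y b * (∏ c ∈ range b, (1 + y c)) * (∏ c ∈ Ico (b + 1) k, (1 + t * y c)) -
      y b * (∏ c ∈ range b, (1 + t * y c)) * (∏ c ∈ Ico (b + 1) k, (1 + t * y c)) := by
  have hs : ∀ a < k, (∑ c ∈ range (a + 1), f c) * (1 + y a) =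
      (∑ c ∈ range a, f c) * (1 + t * y a) + y a * (∑ c ∈ range k, f c) +
        if a = b then y b else 0 := by
    intro a ha
    have h1 := h a ha
    have h2 := Finset.sum_range_add_sum_Ico f (show a + 1 ≤ k from ha)
    rw [Finset.sum_range_succ] at h2 ⊢
    linear_combination h1 + y a * h2
  have T := tele t _ y (fun m => ∑ c ∈ range m, f c) _ k hs (by simp)
  have Tk := T k le_rfl
  have Tb := T b hb.le
  have e1 : ∑ a ∈ range k, (if a = b then y b else 0) * (∏ c ∈ range a, (1 + y c)) *
        ∏ c ∈ Ico (a + 1) k, (1 + t * y c) = y b * (∏ c ∈ range b, (1 + y c)) *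
        ∏ c ∈ Ico (b + 1) k, (1 + t * y c) := by
    rw [Finset.sum_eq_single b]
    · simp
    · intro c _ hc
      simp [hc]
    · simp [hb.not_ge]
  have e2 : ∑ a ∈ range b, (if a = b then y b else 0) * (∏ c ∈ range a, (1 + y c)) *
        ∏ c ∈ Ico (a + 1) b, (1 + t * y c) = 0 := by
    apply Finset.sum_eq_zero
    intro c hc
    rw [if_neg (by simp at hc; omega)]
    simp
  simp only [e1] at Tk
  simp only [e2] at Tb
  have hP : ∏ c ∈ range b, (1 + y c) ≠ 0 := Finset.prod_ne_zero_iff.mpr fun c _ => hy c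
  apply mul_left_cancel₀ (mul_ne_zero ht hP)
  linear_combination (∏ c ∈ range k, (1 + t * y c) - t * ∏ c ∈ range k, (1 + y c)) * Tb +
    (∏ c ∈ range b, (1 + y c) - ∏ c ∈ range b, (1 + t * y c)) * Tk

end abstractPart

/-- series in the elementary symmetric polynomials -/
def eser (k : ℕ) (g : ℕ → Polynomial (MvPolynomial (Fin k) ℤ)) :
    PowerSeries (Polynomial (MvPolynomial (Fin k) ℤ)) :=
  PowerSeries.mk fun i => g i * Polynomial.C (esymm (Fin k) ℤ i)

/-- the letter variable -/
def yv (k : ℕ) (c : Fin k) : PowerSeries (Polynomial (MvPolynomial (Fin k) ℤ)) :=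
  PowerSeries.X * PowerSeries.C (Polynomial.C (MvPolynomial.X c))

lemma eser_sum (k : ℕ) (g : ℕ → Polynomial (MvPolynomial (Fin k) ℤ)) :
    ∑ s : Finset (Fin k), PowerSeries.C (g s.card) * ∏ c ∈ s, yv k c = eser k g := by
  ext1 n
  rw [map_sum]
  simp only [yv, Finset.prod_mul_distrib, Finset.prod_const, ← map_prod, eser,
    PowerSeries.coeff_mk]
  have : ∀ s : Finset (Fin k), PowerSeries.coeff n (PowerSeries.C (g s.card) *
      (PowerSeries.X ^ s.card * PowerSeries.C (Polynomial.C (∏ c ∈ s, MvPolynomial.X c)))) =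
      if s.card = n then g n * Polynomial.C (∏ c ∈ s, MvPolynomial.X c) else 0 := by
    intro s
    rw [PowerSeries.coeff_C_mul, mul_comm (PowerSeries.X ^ _), PowerSeries.coeff_C_mul,
      PowerSeries.coeff_X_pow]
    by_cases h : s.card = n
    · simp [h]
    · simp [h, Ne.symm h]
  simp_rw [this]
  rw [← Finset.sum_filter, esymm, map_sum, Finset.mul_sum]
  refine Finset.sum_congr ?_ fun _ _ => rfl
  ext s
  simp [Finset.mem_powersetCard]

lemma prod_general {k : ℕ} {R : Type*} [CommRing R] (s : R) (y : Fin k → R) :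
    ∏ c, (1 + s * y c) = ∑ S : Finset (Fin k), s ^ S.card * ∏ c ∈ S, y c := by
  rw [Finset.prod_one_add]
  simp [Finset.prod_mul_distrib]

lemma deriv_general {k : ℕ} {R : Type*} [CommRing R] (s : R) (y : Fin k → R) :
    ∑ b, y b * ∏ c ∈ univ.erase b, (1 + s * y c) =
      ∑ S : Finset (Fin k), (S.card * s ^ (S.card - 1)) * ∏ c ∈ S, y c := by
  have h := prod_general (Polynomial.X : Polynomial R) (fun c => Polynomial.C (y c))
  have h' := congrArg (fun p => Polynomial.eval s (Polynomial.derivative p)) h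
  simp only [← map_prod] at h'
  rw [Polynomial.derivative_prod_finset, Polynomial.derivative_sum] at h'
  rw [Polynomial.eval_finsetSum, Polynomial.eval_finsetSum] at h'
  convert h' using 1
  · refine Finset.sum_congr rfl fun b _ => ?_
    rw [Polynomial.eval_mul, Polynomial.eval_prod, mul_comm]
    simp
    simp only [mul_comm s]
  · refine Finset.sum_congr rfl fun S _ => ?_
    rw [Polynomial.derivative_mul, Polynomial.derivative_C, Polynomial.derivative_X_pow]
    simp [Polynomial.eval_prod]

/-- generating series of the words with given ends -/
def fser (k : ℕ) (b a : Fin k) : PowerSeries (Polynomial (MvPolynomial (Fin k) ℤ)) :=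
  PowerSeries.mk fun n => if n = 0 then 0 else sendSum k (n - 1) b a

lemma fser_rec (k : ℕ) (b a : Fin k) :
    fser k b a = yv k a * (∑ c, PowerSeries.C (swt k a c) * fser k b c) +
      if a = b then yv k b else 0 := by
  ext1 n
  rw [map_add, yv, mul_assoc]
  rcases n with _ | n
  · simp only [PowerSeries.coeff_zero_X_mul]
    split_ifs <;> simp [fser, yv]
  · rw [PowerSeries.coeff_succ_X_mul, PowerSeries.coeff_C_mul, map_sum]
    simp only [PowerSeries.coeff_C_mul, fser, PowerSeries.coeff_mk]
    rcases n with _ | n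
    · simp only [if_true, mul_zero, Finset.sum_const_zero, zero_add, Nat.sub_self,
        sendSum_zero]
      split_ifs <;> simp_all [yv]
    · have : PowerSeries.coeff (n + 1 + 1) (if a = b then yv k b else 0) = 0 := by
        split_ifs
        · rw [yv, PowerSeries.coeff_succ_X_mul, PowerSeries.coeff_C]
          simp
        · simp
      rw [this, add_zero]
      simp [sendSum_succ]

lemma wser_eq (k : ℕ) :
    PowerSeries.mk (fun n => if n = 0 then 0 else smirnovEnum ℤ n k desc FirstLtLast) =
      ∑ b, ∑ a, if a < b then fser k b a else 0 := by
  ext1 n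
  simp only [map_sum, PowerSeries.coeff_mk]
  rcases n with _ | n
  · rw [if_pos rfl]
    symm
    refine Finset.sum_eq_zero fun b _ => Finset.sum_eq_zero fun a _ => ?_
    split_ifs <;> simp [fser]
  · rw [if_neg (by omega), smirnovEnum_succ]
    refine Finset.sum_congr rfl fun b _ => Finset.sum_congr rfl fun a _ => ?_
    split_ifs <;> simp [fser]

/-- extension by zero to the natural numbers -/
def extz {A : Type*} [Zero A] (k : ℕ) (f : Fin k → A) (n : ℕ) : A :=
  if h : n < k then f ⟨n, h⟩ else 0

lemma extz_val {A : Type*} [Zero A] (k : ℕ) (f : Fin k → A) (i : Fin k) :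
    extz k f i = f i := by
  simp [extz]

set_option maxHeartbeats 1000000 in
lemma main_one (k : ℕ) (b : Fin k) :
    (∏ c, (1 + PowerSeries.C Polynomial.X * yv k c) -
      PowerSeries.C Polynomial.X * ∏ c, (1 + yv k c)) *
        (∑ a, if a < b then fser k b a else 0) =
      extz k (yv k) b * (∏ c ∈ range b, (1 + extz k (yv k) c)) *
        (∏ c ∈ Ico ((b : ℕ) + 1) k, (1 + PowerSeries.C Polynomial.X * extz k (yv k) c)) -
      yv k b * ∏ c ∈ univ.erase b, (1 + PowerSeries.C Polynomial.X * yv k c) := by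
  have ht : (1 - PowerSeries.C Polynomial.X :
      PowerSeries (Polynomial (MvPolynomial (Fin k) ℤ))) ≠ 0 := by
    rw [← map_one PowerSeries.C, ← map_sub]
    intro h
    rw [map_eq_zero_iff _ PowerSeries.C_injective] at h
    have := congrArg (Polynomial.eval 0) h
    simp at this
  have hy : ∀ c, 1 + extz k (yv k) c ≠ 0 := by
    intro c h
    have := congrArg PowerSeries.constantCoeff h
    unfold extz at this
    split_ifs at this <;> simp [yv] at this
  have key := absOne (PowerSeries.C Polynomial.X) (extz k (yv k)) (extz k (fser k b)) k b
    b.isLt ht hy (by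
      intro a ha
      have hr := fser_rec k b ⟨a, ha⟩
      have e1 : extz k (fser k b) a = fser k b ⟨a, ha⟩ := by simp [extz, ha]
      have e2 : extz k (yv k) a = yv k ⟨a, ha⟩ := by simp [extz, ha]
      rw [e1, hr, e2, extz_val]
      have e3 : ∑ c, PowerSeries.C (swt k ⟨a, ha⟩ c) * fser k b c =
          ∑ c ∈ Ico (a + 1) k, extz k (fser k b) c +
            PowerSeries.C Polynomial.X * ∑ c ∈ range a, extz k (fser k b) c := by
        have e4 : ∀ c : Fin k, PowerSeries.C (swt k ⟨a, ha⟩ c) * fser k b c =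
            (fun n : ℕ => (if a < n then 1 else if n < a then PowerSeries.C Polynomial.X else 0)
              * extz k (fser k b) n) (c : ℕ) := by
          intro c
          simp only [extz_val, swt, Fin.lt_def]
          split_ifs <;> simp
        rw [Finset.sum_congr rfl fun c _ => e4 c, Fin.sum_univ_eq_sum_range (fun n : ℕ => (if a < n then 1 else
            if n < a then PowerSeries.C Polynomial.X else 0) * extz k (fser k b) n) k,
          ← Finset.sum_range_add_sum_Ico _ (show a + 1 ≤ k from ha), Finset.sum_range_succ,
          Finset.mul_sum]
        simp only [lt_irrefl, if_false, zero_mul, add_zero]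
        rw [add_comm]
        refine congrArg₂ (· + ·) ?_ ?_
        · refine Finset.sum_congr rfl fun c hc => ?_
          rw [Finset.mem_Ico] at hc
          rw [if_pos (by omega), one_mul]
        · refine Finset.sum_congr rfl fun c hc => ?_
          rw [Finset.mem_range] at hc
          rw [if_neg (by omega), if_pos hc]
      rw [e3]
      simp [Fin.ext_iff])
  rw [← Fin.prod_univ_eq_prod_range (fun c => 1 + PowerSeries.C Polynomial.X * extz k (yv k) c),
    ← Fin.prod_univ_eq_prod_range (fun c => 1 + extz k (yv k) c)] at key
  simp only [extz_val] at key
  have e5 : ∑ a ∈ range b, extz k (fser k b) a = ∑ a, if a < b then fser k b a else 0 := by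
    have : ∀ a : Fin k, (if a < b then fser k b a else 0) =
        (fun n : ℕ => if n < b then extz k (fser k b) n else 0) a := by
      intro a
      simp only [extz_val, Fin.lt_def]
    rw [Finset.sum_congr rfl fun a _ => this a, Fin.sum_univ_eq_sum_range
      (fun n : ℕ => if n < b then extz k (fser k b) n else 0) k, ← Finset.sum_filter]
    refine Finset.sum_congr ?_ fun _ _ => rfl
    ext n
    have := b.isLt
    simp only [Finset.mem_range, Finset.mem_filter]
    omega
  rw [e5] at key
  rw [key, extz_val, mul_assoc (yv k b) (∏ c ∈ range (b : ℕ), (1 + PowerSeries.C _ * _))]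
  refine congrArg₂ (· - ·) rfl (congrArg₂ (· * ·) rfl ?_)
  rw [Finset.range_eq_Ico, ← Finset.prod_union]
  · symm
    refine Finset.prod_bij (fun (c : Fin k) _ => (c : ℕ)) ?_ ?_ ?_ ?_
    · intro c hc
      have h1 : c ≠ b := by simpa using hc
      have h2 : (c : ℕ) ≠ b := fun h => h1 (Fin.ext h)
      have := c.isLt
      simp only [Finset.mem_union, Finset.mem_Ico]
      omega
    · intro c _ d _ h
      exact Fin.ext h
    · intro n hn
      have := b.isLt
      simp only [Finset.mem_union, Finset.mem_Ico] at hn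
      refine ⟨⟨n, by omega⟩, ?_, rfl⟩
      simp only [Finset.mem_erase, Finset.mem_univ, and_true, ne_eq, Fin.ext_iff]
      omega
    · intro c _
      rw [extz_val]
  · rw [Finset.disjoint_left]
    intro n h1 h2
    rw [Finset.mem_Ico] at h1 h2
    omega

lemma acoeff_aux {R : Type*} [CommRing R] (t : R) (m : ℕ) :
    (1 - t) ^ 2 * ∑ j ∈ Finset.range m, ((j : R) + 1) * t ^ j =
      1 - t ^ (m + 1) - (1 - t) * (((m + 1 : ℕ) : R) * t ^ m) := by
  induction m with
  | zero => simp
  | succ m ih =>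
    rw [Finset.sum_range_succ, mul_add, ih]
    push_cast
    ring

/-- `D(x,t,z) · Σ_{n≥1} W_n^<(x,t) z^n = Σ_{i≥2} a_i(t) e_i(x) z^i`,
where `a_i(t) = Σ_{j=0}^{i-2} (j+1) t^j`. -/
theorem smirnov_lt_enumerator (k : ℕ) (hk : 1 ≤ k) :
    Dser ℤ k *
      PowerSeries.mk (fun n => if n = 0 then 0 else smirnovEnum ℤ n k desc FirstLtLast) =
    PowerSeries.mk (fun i =>
      if 2 ≤ i then
        (∑ j ∈ Finset.range (i - 1),
            ((j : Polynomial (MvPolynomial (Fin k) ℤ)) + 1) * Polynomial.X ^ j) *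
          Polynomial.C (esymm (Fin k) ℤ i)
      else 0) := by
  have ht : (1 - PowerSeries.C Polynomial.X :
      PowerSeries (Polynomial (MvPolynomial (Fin k) ℤ))) ≠ 0 := by
    rw [← map_one PowerSeries.C, ← map_sub]
    intro h
    rw [map_eq_zero_iff _ PowerSeries.C_injective] at h
    have := congrArg (Polynomial.eval 0) h
    simp at this
  have hP : ∏ c, (1 + yv k c) = eser k (fun _ => 1) := by
    have := prod_general 1 (yv k)
    simp only [one_mul, one_pow] at this
    rw [this, ← eser_sum]
    simp
  have hQ : ∏ c, (1 + PowerSeries.C Polynomial.X * yv k c) =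
      eser k (fun i => Polynomial.X ^ i) := by
    rw [prod_general, ← eser_sum]
    simp
  have hE : ∑ b, yv k b * ∏ c ∈ univ.erase b, (1 + PowerSeries.C Polynomial.X * yv k c) =
      eser k (fun i => (i : Polynomial (MvPolynomial (Fin k) ℤ)) * Polynomial.X ^ (i - 1)) := by
    rw [deriv_general, ← eser_sum]
    simp
  have hD : (1 - PowerSeries.C Polynomial.X) * Dser ℤ k =
      ∏ c, (1 + PowerSeries.C Polynomial.X * yv k c) -
      PowerSeries.C Polynomial.X * ∏ c, (1 + yv k c) := by
    rw [hP, hQ, ← map_one PowerSeries.C, ← map_sub]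
    ext1 n
    rw [map_sub (PowerSeries.coeff n), PowerSeries.coeff_C_mul, PowerSeries.coeff_C_mul]
    simp only [eser, Dser, PowerSeries.coeff_mk]
    rcases n with _ | _ | n
    · simp
    · simp [mul_comm]
    · simp only [Nat.add_eq_zero_iff, one_ne_zero, and_false, if_false, Nat.add_eq_right,
        Nat.add_sub_cancel, tnum]
      have := mul_geom_sum (Polynomial.X : Polynomial (MvPolynomial (Fin k) ℤ)) (n + 1)
      linear_combination (Polynomial.X * Polynomial.C (esymm (Fin k) ℤ (n + 1 + 1))) * this
  rw [wser_eq]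
  have hsum := Finset.sum_congr (rfl : (univ : Finset (Fin k)) = univ)
    fun b _ => main_one k b
  rw [← Finset.mul_sum, Finset.sum_sub_distrib, hE, ← hD,
    Fin.sum_univ_eq_sum_range (fun b => extz k (yv k) b *
      (∏ c ∈ range b, (1 + extz k (yv k) c)) *
        (∏ c ∈ Ico (b + 1) k, (1 + PowerSeries.C Polynomial.X * extz k (yv k) c)))] at hsum
  have h2 := tele2 (PowerSeries.C Polynomial.X) (extz k (yv k)) k
  rw [← Fin.prod_univ_eq_prod_range (fun c => 1 + PowerSeries.C Polynomial.X * extz k (yv k) c),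
    ← Fin.prod_univ_eq_prod_range (fun c => 1 + extz k (yv k) c)] at h2
  simp only [extz_val] at h2
  rw [hP, hQ] at h2
  apply mul_left_cancel₀ (mul_ne_zero ht ht)
  have h3 : eser k (fun _ => 1) - eser k (fun i => Polynomial.X ^ i) -
      (1 - PowerSeries.C Polynomial.X) * eser k (fun i =>
        (i : Polynomial (MvPolynomial (Fin k) ℤ)) * Polynomial.X ^ (i - 1)) =
      (1 - PowerSeries.C Polynomial.X) * (1 - PowerSeries.C Polynomial.X) *
      PowerSeries.mk (fun i =>
      if 2 ≤ i then
        (∑ j ∈ Finset.range (i - 1),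
            ((j : Polynomial (MvPolynomial (Fin k) ℤ)) + 1) * Polynomial.X ^ j) *
          Polynomial.C (esymm (Fin k) ℤ i)
      else 0) := by
    rw [← map_one PowerSeries.C, ← map_sub, ← map_mul]
    ext1 n
    rw [map_sub, map_sub, PowerSeries.coeff_C_mul, PowerSeries.coeff_C_mul]
    simp only [eser, PowerSeries.coeff_mk]
    rcases n with _ | _ | n
    · simp
    · simp
      ring
    · have := acoeff_aux (Polynomial.X : Polynomial (MvPolynomial (Fin k) ℤ)) (n + 1)
      rw [if_pos (by omega)]
      simp only [Nat.add_sub_cancel]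
      linear_combination (-Polynomial.C (esymm (Fin k) ℤ (n + 1 + 1))) * this
  rw [← h3]
  linear_combination (1 - PowerSeries.C Polynomial.X) * hsum + h2

end
end

section
/- For every k ≥ 1, the following identity of formal power series in z with coefficients in ℤ[x_1,…,x_k,t] holds: D(x,t,z) · Σ_{n≥1} W_n^>(x,t) z^n = Σ_{i≥2} b_i(t) e_i(x) z^i, where b_i(t) := Σ_{j=1}^{i−1} (i−j) t^j and W_n^>(x,t) := Σ_w t^{des(w)} x_w, the sum over all Smirnov words w of length n over [k] with w_1 > w_n. -/
open Finset MvPolynomial Polynomial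

attribute [local instance] Classical.propDecidable

noncomputable section

/-- transfer weight of a pair of adjacent letters -/
def mwt {k : ℕ} (b c : Fin k) : Polynomial (MvPolynomial (Fin k) ℤ) :=
  if b = c then 0 else if c < b then Polynomial.X else 1

/-- weight of a word -/
def wwt {n k : ℕ} (w : Fin (n + 1) → Fin k) : Polynomial (MvPolynomial (Fin k) ℤ) :=
  (∏ i, Polynomial.C (MvPolynomial.X (w i))) * ∏ i : Fin n, mwt (w i.castSucc) (w i.succ)

/-- total weight of words of length `n+1` from `b` to `a` -/
def Vwt {k : ℕ} : ℕ → Fin k → Fin k → Polynomial (MvPolynomial (Fin k) ℤ)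
  | 0, b, a => if b = a then Polynomial.C (MvPolynomial.X b) else 0
  | n + 1, b, a => Polynomial.C (MvPolynomial.X b) * ∑ c, mwt b c * Vwt n c a

theorem wwt_cons {n k : ℕ} (b : Fin k) (v : Fin (n + 1) → Fin k) :
    wwt (Fin.cons b v : Fin (n + 2) → Fin k) =
      Polynomial.C (MvPolynomial.X b) * (mwt b (v 0) * wwt v) := by
  unfold wwt
  rw [Fin.prod_univ_succ (n := n + 1)]
  rw [Fin.prod_univ_succ (n := n) (fun i => mwt ((Fin.cons b v : Fin (n + 2) → Fin k) i.castSucc)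
    ((Fin.cons b v : Fin (n + 2) → Fin k) i.succ))]
  simp only [Fin.cons_zero, Fin.cons_succ, Fin.castSucc_zero, Fin.castSucc_succ]
  ring

theorem sum_wwt {k : ℕ} (n : ℕ) (F : Fin k → Fin k → Polynomial (MvPolynomial (Fin k) ℤ)) :
    ∑ w : Fin (n + 1) → Fin k, wwt w * F (w 0) (w (Fin.last n)) =
      ∑ b, ∑ a, Vwt n b a * F b a := by
  induction n generalizing F with
  | zero =>
    rw [← (Equiv.funUnique (Fin 1) (Fin k)).symm.sum_comp]
    simp [wwt, Vwt, ite_mul]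
  | succ n ih =>
    rw [← (Fin.consEquiv (fun _ : Fin (n + 2) => Fin k)).sum_comp, Fintype.sum_prod_type]
    refine Finset.sum_congr rfl fun b _ => ?_
    have h := ih (fun c a => Polynomial.C (MvPolynomial.X b) * mwt b c * F b a)
    have e : ∀ v : Fin (n + 1) → Fin k,
        wwt ((Fin.consEquiv (fun _ : Fin (n + 2) => Fin k)) (b, v)) *
          F ((Fin.consEquiv (fun _ : Fin (n + 2) => Fin k)) (b, v) 0)
            ((Fin.consEquiv (fun _ : Fin (n + 2) => Fin k)) (b, v) (Fin.last (n + 1))) =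
        wwt v * (Polynomial.C (MvPolynomial.X b) * mwt b (v 0) * F b (v (Fin.last n))) := by
      intro v
      have : (Fin.consEquiv (fun _ : Fin (n + 2) => Fin k)) (b, v) =
        (Fin.cons b v : Fin (n + 2) → Fin k) := rfl
      rw [this, wwt_cons, ← Fin.succ_last, Fin.cons_succ, Fin.cons_zero]
      ring
    rw [Finset.sum_congr rfl fun v _ => e v, h, Finset.sum_comm]
    refine Finset.sum_congr rfl fun a _ => ?_
    simp only [Vwt, Finset.mul_sum, Finset.sum_mul]
    refine Finset.sum_congr rfl fun c _ => ?_
    ring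

theorem wwt_eq {n k : ℕ} (w : Fin (n + 1) → Fin k) :
    wwt w = if IsSmirnov w then
      Polynomial.X ^ desc w * Polynomial.C (xw ℤ w) else 0 := by
  unfold wwt
  split_ifs with h
  · have h1 : ∀ i : Fin n, mwt (w i.castSucc) (w i.succ) =
        if w i.succ < w i.castSucc then Polynomial.X else 1 := by
      intro i
      have : w i.castSucc ≠ w i.succ := by
        have := h i.castSucc (by simp)
        exact fun e => this e.symm
      simp [mwt, this]
    have h2 : desc w = (Finset.univ.filter fun i : Fin n => w i.succ < w i.castSucc).card := by
      unfold desc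
      rw [← Finset.card_map (s := Finset.univ.filter fun i : Fin n => w i.succ < w i.castSucc)
        Fin.castSuccEmb]
      refine congrArg Finset.card ?_
      ext i
      simp only [Finset.mem_filter, Finset.mem_univ, true_and, Finset.mem_map]
      constructor
      · rintro ⟨hi, hlt⟩
        exact ⟨⟨i, by omega⟩, hlt, rfl⟩
      · rintro ⟨j, hj, rfl⟩
        exact ⟨by simp, hj⟩
    rw [Finset.prod_congr rfl fun i _ => h1 i, Finset.prod_ite, h2]
    simp [xw, map_prod]
    ring
  · unfold IsSmirnov at h
    push Not at h
    obtain ⟨i, hi, he⟩ := h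
    have : mwt (w (Fin.castSucc (⟨i, by omega⟩ : Fin n))) (w (Fin.succ (⟨i, by omega⟩ : Fin n))) = 0 := by
      unfold mwt
      rw [if_pos]
      exact he.symm
    rw [Finset.prod_eq_zero (Finset.mem_univ (⟨i, by omega⟩ : Fin n)) this, mul_zero]

theorem smirnovEnum_eq (n k : ℕ) :
    smirnovEnum ℤ (n + 1) k desc FirstGtLast = ∑ b, ∑ a, if a < b then Vwt n b a else 0 := by
  have := sum_wwt (k := k) n (fun b a => if a < b then 1 else 0)
  simp only [mul_ite, mul_one, mul_zero] at this
  rw [← this, smirnovEnum, Finset.sum_filter]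
  refine Finset.sum_congr rfl fun w _ => ?_
  have h : FirstGtLast w ↔ w (Fin.last n) < w 0 := by
    constructor
    · rintro ⟨_, h⟩; exact h
    · intro h; exact ⟨Nat.succ_pos _, h⟩
  rw [wwt_eq, h]
  by_cases h1 : IsSmirnov w <;> by_cases h2 : w (Fin.last n) < w 0 <;> simp [h1, h2]

/-- solving the linear system for a fixed last letter `a` -/
theorem solve_system {B : Type*} [CommRing B] (y G : ℕ → B) (t : B) (k a : ℕ)
    (ha : a < k)
    (h : ∀ b < k, G b = y b * ((if b = a then 1 else 0) + ∑ c ∈ Finset.Ico (b + 1) k, G c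
      + t * ∑ c ∈ Finset.range b, G c)) :
    (∑ c ∈ Finset.range k, G c) *
        (∏ c ∈ Finset.range k, (1 + t * y c) - t * ∏ c ∈ Finset.range k, (1 + y c)) =
      (1 - t) * (y a * (∏ c ∈ Finset.range a, (1 + y c)) *
        ∏ c ∈ Finset.Ico (a + 1) k, (1 + t * y c)) ∧
    (t * (∑ c ∈ Finset.range k, G c) + (1 - t) * ∑ c ∈ Finset.Ico (a + 1) k, G c) *
        ∏ c ∈ Finset.Ico (a + 1) k, (1 + t * y c) =
      t * (∑ c ∈ Finset.range k, G c) * ∏ c ∈ Finset.Ico (a + 1) k, (1 + y c) := by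
  set T := ∑ c ∈ Finset.range k, G c with hT
  have hI : ∀ b < k, ∑ c ∈ Finset.Ico (b + 1) k, G c = T - ∑ c ∈ Finset.range b, G c - G b := by
    intro b hb
    rw [hT, ← Finset.sum_range_add_sum_Ico G (show b + 1 ≤ k by omega), Finset.sum_range_succ]
    ring
  set Q : ℕ → B := fun b => T - (1 - t) * ∑ c ∈ Finset.range b, G c with hQ
  have step : ∀ b < k, Q (b + 1) * (1 + y b) =
      Q b * (1 + t * y b) - (1 - t) * (if b = a then y b else 0) := by
    intro b hb
    have h1 := h b hb
    rw [hI b hb] at h1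
    simp only [hQ, Finset.sum_range_succ]
    split_ifs at h1 ⊢ <;> linear_combination (-(1 - t)) * h1
  have s1 : ∀ b ≤ a, Q b * ∏ c ∈ Finset.range b, (1 + y c) =
      T * ∏ c ∈ Finset.range b, (1 + t * y c) := by
    intro b
    induction b with
    | zero => intro _; simp [hQ]
    | succ b ih =>
      intro hb
      have h1 := step b (by omega)
      rw [if_neg (by omega)] at h1
      rw [Finset.prod_range_succ, Finset.prod_range_succ]
      linear_combination (∏ c ∈ Finset.range b, (1 + y c)) * h1 + (1 + t * y b) * ih (by omega)
  have s2 : ∀ b, a + 1 ≤ b → b ≤ k → Q b * ∏ c ∈ Finset.Ico (a + 1) b, (1 + y c) =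
      Q (a + 1) * ∏ c ∈ Finset.Ico (a + 1) b, (1 + t * y c) := by
    intro b hab
    induction b, hab using Nat.le_induction with
    | base => intro _; simp
    | succ b hb ih =>
      intro hk
      have h1 := step b (by omega)
      rw [if_neg (by omega)] at h1
      rw [Finset.prod_Ico_succ_top hb, Finset.prod_Ico_succ_top hb]
      linear_combination (∏ c ∈ Finset.Ico (a + 1) b, (1 + y c)) * h1 +
        (1 + t * y b) * ih (by omega)
  have e1 := s1 a le_rfl
  have e2 := s2 k (by omega) le_rfl
  have e3 := step a ha
  rw [if_pos rfl] at e3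
  have hk : Q k = t * T := by simp only [hQ, ← hT]; ring
  have ha1 : Q (a + 1) = t * T + (1 - t) * ∑ c ∈ Finset.Ico (a + 1) k, G c := by
    rw [hI a ha]; simp only [hQ, Finset.sum_range_succ]; ring
  constructor
  · rw [← Finset.prod_range_mul_prod_Ico _ (show a + 1 ≤ k by omega),
      ← Finset.prod_range_mul_prod_Ico (fun c => 1 + y c) (show a + 1 ≤ k by omega),
      Finset.prod_range_succ, Finset.prod_range_succ]
    rw [hk] at e2
    linear_combination (-(∏ c ∈ Finset.range a, (1 + y c)) * (1 + y a)) * e2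
      - (∏ c ∈ Finset.range a, (1 + y c)) * (∏ c ∈ Finset.Ico (a + 1) k, (1 + t * y c)) * e3
      - (1 + t * y a) * (∏ c ∈ Finset.Ico (a + 1) k, (1 + t * y c)) * e1
  · rw [← ha1, ← e2, hk]

theorem telescope {B : Type*} [CommRing B] (y : ℕ → B) (t : B) (k : ℕ) :
    (1 - t) * ∑ a ∈ Finset.range k, y a * (∏ c ∈ Finset.range a, (1 + y c)) *
        ∏ c ∈ Finset.Ico (a + 1) k, (1 + t * y c) =
      ∏ c ∈ Finset.range k, (1 + y c) - ∏ c ∈ Finset.range k, (1 + t * y c) := by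
  induction k with
  | zero => simp
  | succ k ih =>
    rw [Finset.sum_range_succ, Finset.prod_range_succ, Finset.prod_range_succ]
    have : ∀ a ∈ Finset.range k, y a * (∏ c ∈ Finset.range a, (1 + y c)) *
        ∏ c ∈ Finset.Ico (a + 1) (k + 1), (1 + t * y c) =
        (y a * (∏ c ∈ Finset.range a, (1 + y c)) *
        ∏ c ∈ Finset.Ico (a + 1) k, (1 + t * y c)) * (1 + t * y k) := by
      intro a ha
      rw [Finset.mem_range] at ha
      rw [Finset.prod_Ico_succ_top (by omega)]
      ring
    rw [Finset.sum_congr rfl this, ← Finset.sum_mul]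
    simp only [Finset.Ico_self, Finset.prod_empty]
    linear_combination (1 + t * y k) * ih

theorem deriv_prod {A : Type*} [CommRing A] (x : ℕ → A) (k : ℕ) :
    PowerSeries.X * PowerSeries.derivative A (∏ c ∈ Finset.range k, (1 + PowerSeries.C (x c) * PowerSeries.X)) =
      ∑ a ∈ Finset.range k, (PowerSeries.C (x a) * PowerSeries.X) *
        (∏ c ∈ Finset.range a, (1 + PowerSeries.C (x c) * PowerSeries.X)) *
        ∏ c ∈ Finset.Ico (a + 1) k, (1 + PowerSeries.C (x c) * PowerSeries.X) := by
  induction k with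
  | zero =>
    ext n
    simp 
  | succ k ih =>
    have : ∀ a ∈ Finset.range k, (PowerSeries.C (x a) * PowerSeries.X) *
        (∏ c ∈ Finset.range a, (1 + PowerSeries.C (x c) * PowerSeries.X)) *
        ∏ c ∈ Finset.Ico (a + 1) (k + 1), (1 + PowerSeries.C (x c) * PowerSeries.X) =
        ((PowerSeries.C (x a) * PowerSeries.X) *
        (∏ c ∈ Finset.range a, (1 + PowerSeries.C (x c) * PowerSeries.X)) *
        ∏ c ∈ Finset.Ico (a + 1) k, (1 + PowerSeries.C (x c) * PowerSeries.X)) *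
          (1 + PowerSeries.C (x k) * PowerSeries.X) := by
      intro a ha
      rw [Finset.mem_range] at ha
      rw [Finset.prod_Ico_succ_top (by omega)]
      ring
    rw [Finset.sum_range_succ, Finset.sum_congr rfl this, ← Finset.sum_mul, ← ih,
      Finset.prod_range_succ, Derivation.leibniz]
    have hd : PowerSeries.derivative A (1 + PowerSeries.C (x k) * PowerSeries.X) =
        PowerSeries.C (x k) := by
      ext n
      rcases n with _ | n <;>
      rw [PowerSeries.coeff_derivative] <;>
      simp [PowerSeries.coeff_one, PowerSeries.coeff_X, PowerSeries.coeff_C]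
    rw [hd]
    simp only [Finset.Ico_self, Finset.prod_empty, smul_eq_mul]
    ring

theorem prod_eq_esymm (k : ℕ) (s : Polynomial (MvPolynomial (Fin k) ℤ)) :
    ∏ c : Fin k, (1 + PowerSeries.C s *
        (PowerSeries.C (Polynomial.C (MvPolynomial.X c)) * PowerSeries.X)) =
      PowerSeries.mk fun i => s ^ i * Polynomial.C (esymm (Fin k) ℤ i) := by
  rw [Finset.prod_one_add]
  ext1 n
  have : ∀ S : Finset (Fin k), ∏ c ∈ S, (PowerSeries.C s *
        (PowerSeries.C (Polynomial.C (MvPolynomial.X c : MvPolynomial (Fin k) ℤ)) * PowerSeries.X)) =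
      PowerSeries.C (s ^ S.card * Polynomial.C (∏ c ∈ S, MvPolynomial.X c)) *
        PowerSeries.X ^ S.card := by
    intro S
    simp only [Finset.prod_mul_distrib, Finset.prod_const, map_mul, map_pow, map_prod]
    ring
  simp only [this, map_sum, PowerSeries.coeff_mk, PowerSeries.coeff_C_mul, PowerSeries.coeff_X_pow]
  rw [MvPolynomial.esymm, map_sum, Finset.mul_sum]
  simp only [mul_ite, mul_one, mul_zero]
  rw [← Finset.sum_filter]
  refine Finset.sum_congr ?_ ?_
  · ext S
    simp [Finset.mem_powersetCard, eq_comm]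
  · intro S hS
    rw [(Finset.mem_powersetCard.1 hS).2]

theorem one_sub_mul_D (k : ℕ) :
    (1 - PowerSeries.C Polynomial.X) * Dser ℤ k =
      PowerSeries.mk (fun i => Polynomial.X ^ i * Polynomial.C (esymm (Fin k) ℤ i)) -
      PowerSeries.C Polynomial.X * PowerSeries.mk (fun i => 1 ^ i * Polynomial.C (esymm (Fin k) ℤ i)) := by
  ext1 n
  rw [sub_mul, one_mul]
  simp only [map_sub, PowerSeries.coeff_C_mul, Dser, PowerSeries.coeff_mk, one_pow, one_mul, tnum]
  rcases n with _ | _ | n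
  · simp
  · simp
  · have := geom_sum_mul (Polynomial.X : Polynomial (MvPolynomial (Fin k) ℤ)) (n + 1)
    rw [if_neg (by omega), if_neg (by omega), show n + 1 + 1 - 1 = n + 1 by omega]
    linear_combination (Polynomial.X * Polynomial.C (esymm (Fin k) ℤ (n + 2))) * this

theorem b_identity {A : Type*} [CommRing A] (t : A) (n : ℕ) :
    (1 - t) ^ 2 * ∑ j ∈ Finset.Icc 1 n, ((n + 1 - j : ℕ) : A) * t ^ j =
      t * ((1 - t) * (n + 1) - 1 + t ^ (n + 1)) := by
  have g : ∀ n : ℕ, (1 - t) * ∑ j ∈ Finset.Icc 1 n, t ^ j = t - t ^ (n + 1) := by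
    intro n
    induction n with
    | zero => simp
    | succ n ih =>
      rw [Finset.sum_Icc_succ_top (by omega)]
      linear_combination ih
  induction n with
  | zero => simp
  | succ n ih =>
    have e : ∀ j ∈ Finset.Icc 1 (n + 1), ((n + 1 + 1 - j : ℕ) : A) * t ^ j =
        ((n + 1 - j : ℕ) : A) * t ^ j + t ^ j := by
      intro j hj
      rw [Finset.mem_Icc] at hj
      rw [show n + 1 + 1 - j = (n + 1 - j) + 1 by omega]
      push_cast
      ring
    rw [Finset.sum_congr rfl e, Finset.sum_add_distrib]
    have g1 := g (n + 1)
    rw [Finset.sum_Icc_succ_top (by omega)]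
    rw [show n + 1 - (n + 1) = 0 by omega]
    push_cast
    linear_combination ih + (1 - t) * g1

/-- the series of words from `b` to `a` -/
def Gser {k : ℕ} (b a : Fin k) : PowerSeries (Polynomial (MvPolynomial (Fin k) ℤ)) :=
  PowerSeries.mk fun n => match n with
    | 0 => 0
    | n + 1 => Vwt n b a

theorem Gser_rec {k : ℕ} (b a : Fin k) :
    Gser b a = (PowerSeries.C (Polynomial.C (MvPolynomial.X b)) * PowerSeries.X) *
      ((if b = a then 1 else 0) + ∑ c, PowerSeries.C (mwt b c) * Gser c a) := by
  ext1 n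
  rw [mul_assoc, PowerSeries.coeff_C_mul]
  rcases n with _ | _ | n
  · simp [Gser]
  · rw [PowerSeries.coeff_succ_X_mul]
    simp only [map_add, map_sum, PowerSeries.coeff_C_mul]
    simp only [Gser, PowerSeries.coeff_mk, Vwt]
    split_ifs <;> simp
  · rw [PowerSeries.coeff_succ_X_mul]
    simp only [map_add, map_sum, PowerSeries.coeff_C_mul]
    simp only [Gser, PowerSeries.coeff_mk, Vwt]
    split_ifs <;> simp [PowerSeries.coeff_one]

/-- the variables, indexed by naturals -/
def xnat (k c : ℕ) : Polynomial (MvPolynomial (Fin k) ℤ) :=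
  if h : c < k then Polynomial.C (MvPolynomial.X ⟨c, h⟩) else 0

/-- the series of words from `b` to `a`, indexed by naturals -/
def gnat (k b a : ℕ) : PowerSeries (Polynomial (MvPolynomial (Fin k) ℤ)) :=
  if h : b < k ∧ a < k then Gser ⟨b, h.1⟩ ⟨a, h.2⟩ else 0

theorem gnat_fin {k : ℕ} (b a : Fin k) : gnat k b a = Gser b a := by
  simp [gnat]

theorem xnat_fin {k : ℕ} (b : Fin k) : xnat k b = Polynomial.C (MvPolynomial.X b) := by
  simp [xnat]

theorem gnat_rec (k a b : ℕ) (ha : a < k) (hb : b < k) :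
    gnat k b a = (PowerSeries.C (xnat k b) * PowerSeries.X) *
      ((if b = a then 1 else 0) + ∑ c ∈ Finset.Ico (b + 1) k, gnat k c a
      + PowerSeries.C Polynomial.X * ∑ c ∈ Finset.range b, gnat k c a) := by
  have h := Gser_rec (⟨b, hb⟩ : Fin k) ⟨a, ha⟩
  rw [← gnat_fin, ← xnat_fin] at h
  have e : ∑ c : Fin k, PowerSeries.C (mwt ⟨b, hb⟩ c) * Gser c ⟨a, ha⟩ =
      ∑ c ∈ Finset.range k, (if b = c then 0 else if c < b then PowerSeries.C Polynomial.X else 1) *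
        gnat k c a := by
    rw [Finset.sum_range]
    refine Finset.sum_congr rfl fun c _ => ?_
    have := gnat_fin c ⟨a, ha⟩
    simp only at this
    rw [this]
    congr 1
    unfold mwt
    have h1 : ((⟨b, hb⟩ : Fin k) = c) ↔ b = (c : ℕ) := by rw [Fin.ext_iff]
    have h2 : (c < (⟨b, hb⟩ : Fin k)) ↔ (c : ℕ) < b := Iff.rfl
    by_cases q1 : b = (c : ℕ)
    · rw [if_pos (h1.2 q1), if_pos q1, map_zero]
    · rw [if_neg (fun q => q1 (h1.1 q)), if_neg q1]
      by_cases q2 : (c : ℕ) < b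
      · rw [if_pos (h2.2 q2), if_pos q2]
      · rw [if_neg (fun q => q2 (h2.1 q)), if_neg q2, map_one]
  rw [e, ← Finset.sum_range_add_sum_Ico _ (show b + 1 ≤ k by omega), Finset.sum_range_succ,
    if_pos rfl, zero_mul, add_zero] at h
  have e1 : ∑ c ∈ Finset.range b, (if b = c then 0 else
      if c < b then PowerSeries.C Polynomial.X else 1) * gnat k c a =
      PowerSeries.C Polynomial.X * ∑ c ∈ Finset.range b, gnat k c a := by
    rw [Finset.mul_sum]
    refine Finset.sum_congr rfl fun c hc => ?_
    rw [Finset.mem_range] at hc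
    rw [if_neg (by omega), if_pos hc]
  have e2 : ∑ c ∈ Finset.Ico (b + 1) k, (if b = c then 0 else
      if c < b then PowerSeries.C Polynomial.X else 1) * gnat k c a =
      ∑ c ∈ Finset.Ico (b + 1) k, gnat k c a := by
    refine Finset.sum_congr rfl fun c hc => ?_
    rw [Finset.mem_Ico] at hc
    rw [if_neg (by omega), if_neg (by omega), one_mul]
  rw [e1, e2] at h
  simp only [Fin.mk.injEq] at h
  rw [h]
  ring

theorem series_eq (k : ℕ) :
    PowerSeries.mk (fun n => if n = 0 then 0 else smirnovEnum ℤ n k desc FirstGtLast) =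
      ∑ a ∈ Finset.range k, ∑ c ∈ Finset.Ico (a + 1) k, gnat k c a := by
  have e : ∑ a ∈ Finset.range k, ∑ c ∈ Finset.Ico (a + 1) k, gnat k c a =
      ∑ b : Fin k, ∑ a : Fin k, if a < b then Gser b a else 0 := by
    rw [Finset.sum_range, Finset.sum_comm (s := (Finset.univ : Finset (Fin k)))]
    refine Finset.sum_congr rfl fun a _ => ?_
    have : Finset.Ico ((a : ℕ) + 1) k = (Finset.range k).filter fun c => (a : ℕ) < c := by
      ext c
      simp only [Finset.mem_Ico, Finset.mem_filter, Finset.mem_range]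
      omega
    rw [this, Finset.sum_filter, Finset.sum_range]
    refine Finset.sum_congr rfl fun b _ => ?_
    rw [gnat_fin]
    rfl
  rw [e]
  ext1 n
  simp only [map_sum, PowerSeries.coeff_mk]
  rcases n with _ | n
  · rw [if_pos rfl]
    symm
    refine Finset.sum_eq_zero fun b _ => Finset.sum_eq_zero fun a _ => ?_
    split_ifs <;> simp [Gser]
  · rw [if_neg (by omega), smirnovEnum_eq]
    refine Finset.sum_congr rfl fun b _ => Finset.sum_congr rfl fun a _ => ?_
    split_ifs <;> simp [Gser]

theorem prod_nat (k : ℕ) (s : Polynomial (MvPolynomial (Fin k) ℤ)) :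
    ∏ c ∈ Finset.range k, (1 + PowerSeries.C s * (PowerSeries.C (xnat k c) * PowerSeries.X)) =
      PowerSeries.mk fun i => s ^ i * Polynomial.C (esymm (Fin k) ℤ i) := by
  rw [← prod_eq_esymm, Finset.prod_range]
  refine Finset.prod_congr rfl fun c _ => ?_
  rw [xnat_fin]

/-- `D(x,t,z) · Σ_{n≥1} W_n^>(x,t) z^n = Σ_{i≥2} b_i(t) e_i(x) z^i`,
where `b_i(t) = Σ_{j=1}^{i-1} (i-j) t^j`. -/
theorem smirnov_gt_enumerator (k : ℕ) (hk : 1 ≤ k) :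
    Dser ℤ k *
      PowerSeries.mk (fun n => if n = 0 then 0 else smirnovEnum ℤ n k desc FirstGtLast) =
    PowerSeries.mk (fun i =>
      if 2 ≤ i then
        (∑ j ∈ Finset.Icc 1 (i - 1),
            ((i - j : ℕ) : Polynomial (MvPolynomial (Fin k) ℤ)) * Polynomial.X ^ j) *
          Polynomial.C (esymm (Fin k) ℤ i)
      else 0) := by
  rw [series_eq]
  set t : PowerSeries (Polynomial (MvPolynomial (Fin k) ℤ)) := PowerSeries.C Polynomial.X with ht
  set y : ℕ → PowerSeries (Polynomial (MvPolynomial (Fin k) ℤ)) :=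
    fun c => PowerSeries.C (xnat k c) * PowerSeries.X with hy
  have hEt : ∏ c ∈ Finset.range k, (1 + t * y c) = _ := prod_nat k Polynomial.X
  have hE1 : ∏ c ∈ Finset.range k, (1 + y c) =
      PowerSeries.mk fun i => Polynomial.C (esymm (Fin k) ℤ i) := by
    have := prod_nat k 1
    simp only [map_one, one_mul, one_pow] at this
    exact this
  have hD : (1 - t) * Dser ℤ k =
      ∏ c ∈ Finset.range k, (1 + t * y c) - t * ∏ c ∈ Finset.range k, (1 + y c) := by
    rw [one_sub_mul_D, hEt, hE1]
    simp only [one_pow, one_mul, ht]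
  have ht1 : (1 - t) ≠ 0 := by
    intro h
    have h1 := congrArg (PowerSeries.coeff 0) h
    rw [ht, ← map_one PowerSeries.C, ← map_sub, PowerSeries.coeff_C, if_pos rfl, map_zero] at h1
    have h2 := congrArg (fun p => Polynomial.coeff p 0) h1
    simp at h2
  have key : ∀ a ∈ Finset.range k,
      (1 - t) * (Dser ℤ k * ∑ c ∈ Finset.Ico (a + 1) k, gnat k c a) =
      t * (y a * (∏ c ∈ Finset.range a, (1 + y c)) * ∏ c ∈ Finset.Ico (a + 1) k, (1 + y c)) -
      t * (y a * (∏ c ∈ Finset.range a, (1 + y c)) *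
        ∏ c ∈ Finset.Ico (a + 1) k, (1 + t * y c)) := by
    intro a ha
    rw [Finset.mem_range] at ha
    obtain ⟨h1, h2⟩ := solve_system y (fun c => gnat k c a) t k a ha
      (fun b hb => gnat_rec k a b ha hb)
    rw [← hD] at h1
    have h3 : Dser ℤ k * ∑ c ∈ Finset.range k, gnat k c a = y a *
        (∏ c ∈ Finset.range a, (1 + y c)) * ∏ c ∈ Finset.Ico (a + 1) k, (1 + t * y c) := by
      apply mul_left_cancel₀ ht1
      linear_combination h1
    have hne : ∏ c ∈ Finset.Ico (a + 1) k, (1 + t * y c) ≠ 0 := by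
      rw [Finset.prod_ne_zero_iff]
      intro c _ h
      have h4 := congrArg PowerSeries.constantCoeff h
      simp [hy] at h4
    apply mul_left_cancel₀ hne
    linear_combination Dser ℤ k * h2 + t * (∏ c ∈ Finset.Ico (a + 1) k, (1 + y c) -
      ∏ c ∈ Finset.Ico (a + 1) k, (1 + t * y c)) * h3
  have tot := Finset.sum_congr (rfl : Finset.range k = Finset.range k) key
  rw [← Finset.mul_sum, ← Finset.mul_sum, Finset.sum_sub_distrib, ← Finset.mul_sum,
    ← Finset.mul_sum] at tot
  have tel := telescope y t k
  have der := deriv_prod (xnat k) k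
  rw [← der] at tot
  have fin : (1 - t) ^ 2 * (Dser ℤ k *
        ∑ a ∈ Finset.range k, ∑ c ∈ Finset.Ico (a + 1) k, gnat k c a) =
      t * ((1 - t) * (PowerSeries.X * PowerSeries.derivative _
        (∏ c ∈ Finset.range k, (1 + y c))) - ∏ c ∈ Finset.range k, (1 + y c) +
        ∏ c ∈ Finset.range k, (1 + t * y c)) := by
    linear_combination (1 - t) * tot - t * tel
  apply mul_left_cancel₀ (pow_ne_zero 2 ht1)
  rw [fin, hEt, hE1]
  have e1 : (1 - t) = PowerSeries.C (1 - Polynomial.X) := by rw [map_sub, map_one]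
  rw [e1, ← map_pow, ht]
  ext1 n
  rw [PowerSeries.coeff_C_mul, PowerSeries.coeff_C_mul, map_add,
    map_sub (PowerSeries.coeff n), PowerSeries.coeff_C_mul]
  simp only [PowerSeries.coeff_mk]
  rcases n with _ | _ | n
  · simp
  · rw [PowerSeries.coeff_succ_X_mul, PowerSeries.coeff_derivative]
    simp
    ring
  · rw [PowerSeries.coeff_succ_X_mul, PowerSeries.coeff_derivative, if_pos (by omega)]
    have b := b_identity (Polynomial.X : Polynomial (MvPolynomial (Fin k) ℤ)) (n + 1)
    rw [show n + 1 + 1 - 1 = n + 1 by omega, ← mul_assoc ((1 - Polynomial.X) ^ 2), b]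
    simp only [PowerSeries.coeff_mk]
    ring

end
end

section
/- For every k ≥ 1, the following identity of formal power series in z with coefficients in ℤ[x_1,…,x_k,t] holds: D(x,t,z) · Σ_{n≥1} W_n^=(x,t) z^n = e_1(x) z − Σ_{i≥2} i · t[i−2]_t e_i(x) z^i, where W_n^=(x,t) := Σ_w t^{des(w)} x_w, the sum over all Smirnov words w of length n over [k] with w_1 = w_n. -/
open Finset MvPolynomial Polynomial

attribute [local instance] Classical.propDecidable

noncomputable section

section helpers

attribute [local instance] instDecidableEqFin instDecidableAnd instDecidableEqNat

theorem smAux_det_affine {R : Type*} [CommRing R] {n : ℕ} (A : Matrix (Fin n) (Fin n) R)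
    (u v : Fin n → R) :
    ∃ c : R, ∀ s : R, (A + s • Matrix.vecMulVec u v).det = A.det + s * c := by
  let N : (Fin n ⊕ Unit → R) → Matrix (Fin n ⊕ Unit) (Fin n ⊕ Unit) R := fun r =>
    (Matrix.fromBlocks A (Matrix.of fun i _ => u i) 0 1).updateRow (Sum.inr ()) r
  have key : ∀ s : R, (A + s • Matrix.vecMulVec u v).det
      = (N (Sum.elim (0 : Fin n → R) (fun _ => 1) + s • Sum.elim (-v) (fun _ => 0))).det := by
    intro s
    have h : N (Sum.elim (0 : Fin n → R) (fun _ => 1) + s • Sum.elim (-v) (fun _ => 0))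
        = Matrix.fromBlocks A (Matrix.of fun i (_ : Unit) => u i)
          (Matrix.of fun (_ : Unit) j => - (s * v j)) 1 := by
      ext i j
      rcases i with i | i <;> rcases j with j | j <;>
        simp [N, Matrix.updateRow_apply]
    rw [h, Matrix.det_fromBlocks_one₂₂]
    congr 1
    ext i j
    simp [Matrix.mul_apply, Matrix.vecMulVec_apply]
    ring
  have key2 : ∀ s : R, (A + s • Matrix.vecMulVec u v).det
      = (N (Sum.elim (0 : Fin n → R) (fun _ => 1))).det
        + s * (N (Sum.elim (-v) (fun _ => 0))).det := by
    intro s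
    rw [key s]
    simp only [N]
    rw [Matrix.det_updateRow_add, Matrix.det_updateRow_smul]
  refine ⟨(N (Sum.elim (-v) (fun _ => 0))).det, fun s => ?_⟩
  have h0 := key2 0
  simp only [zero_smul, add_zero, zero_mul] at h0
  rw [key2 s, h0]

/-- the transfer matrix -/
def smAuxM {R : Type*} [CommRing R] {n : ℕ} (t : R) (y : Fin n → R) : Matrix (Fin n) (Fin n) R :=
  Matrix.of fun i j => if i = j then 1 else if i < j then - y j else - (t * y j)

theorem smAux_det {R : Type*} [CommRing R] {n : ℕ} (t : R) (y : Fin n → R) :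
    (1 - t) * (smAuxM t y).det = ∏ i, (1 + t * y i) - t * ∏ i, (1 + y i) := by
  obtain ⟨c, hc⟩ := smAux_det_affine (smAuxM t y) (fun _ => 1) y
  have h1 : (smAuxM t y + (1 : R) • Matrix.vecMulVec (fun _ => 1) y).det = ∏ i, (1 + y i) := by
    rw [Matrix.det_of_isLowerTriangular]
    · simp [smAuxM, Matrix.vecMulVec_apply]
    · intro i j hij
      have hij' : i < j := hij
      simp [smAuxM, Matrix.vecMulVec_apply, hij', hij'.ne]
  have h2 : (smAuxM t y + t • Matrix.vecMulVec (fun _ => 1) y).det = ∏ i, (1 + t * y i) := by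
    rw [Matrix.det_of_isUpperTriangular]
    · simp [smAuxM, Matrix.vecMulVec_apply]
    · intro i j hij
      have hij' : j < i := hij
      simp [smAuxM, Matrix.vecMulVec_apply, hij'.ne', hij'.not_gt]
  rw [← h1, ← h2, hc, hc]
  ring

theorem smAux_coeff_prod {S : Type*} [CommRing S] {n : ℕ} (x : Fin n → S) (j : ℕ) :
    PowerSeries.coeff j (∏ c, (1 + PowerSeries.C (x c) * PowerSeries.X))
      = ∑ T ∈ Finset.powersetCard j Finset.univ, ∏ c ∈ T, x c := by
  rw [Finset.prod_one_add, map_sum]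
  have : ∀ T : Finset (Fin n), PowerSeries.coeff j (∏ c ∈ T, (PowerSeries.C (x c) * PowerSeries.X))
      = if T.card = j then ∏ c ∈ T, x c else 0 := by
    intro T
    rw [Finset.prod_mul_distrib, Finset.prod_const, ← map_prod, PowerSeries.coeff_C_mul,
      PowerSeries.coeff_X_pow]
    simp [eq_comm]
  simp_rw [this]
  rw [← Finset.sum_filter, Finset.powerset_univ]
  congr 1
  ext T
  simp [Finset.mem_powersetCard]

theorem smAux_deriv {S : Type*} [CommRing S] {n : ℕ} (x : Fin (n+1) → S) :
    PowerSeries.derivative S (∏ c, (1 + PowerSeries.C (x c) * PowerSeries.X))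
     = ∑ i, PowerSeries.C (x i) *
        ∏ c, (1 + PowerSeries.C (x (i.succAbove c)) * PowerSeries.X) := by
  have h := congrArg (fun p : S[X] => (p : PowerSeries S)) (Polynomial.derivative_prod_finset (s := Finset.univ)
    (f := fun c => (1 + Polynomial.C (x c) * Polynomial.X)))
  simp only [← PowerSeries.derivative_coe] at h
  have e : ∀ T : Finset (Fin (n+1)), ((∏ c ∈ T, (1 + Polynomial.C (x c) * Polynomial.X) : S[X]) : PowerSeries S)
     = ∏ c ∈ T, (1 + PowerSeries.C (x c) * PowerSeries.X) := by
    intro T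
    rw [← Polynomial.coeToPowerSeries.ringHom_apply, map_prod]
    simp
  rw [e] at h
  rw [h, ← Polynomial.coeToPowerSeries.ringHom_apply, map_sum]
  refine Finset.sum_congr rfl fun i _ => ?_
  rw [map_mul, Polynomial.coeToPowerSeries.ringHom_apply, e, mul_comm]
  congr 1
  · simp
  · rw [← Finset.compl_singleton, ← Fin.image_succAbove_univ,
      Finset.prod_image (fun a _ b _ h => Fin.succAbove_right_injective h)]

theorem smAux_coeff_sum {S : Type*} [CommRing S] {n : ℕ} (x : Fin (n+1) → S) (j : ℕ) :
    PowerSeries.coeff j (∑ i, PowerSeries.C (x i) * PowerSeries.X *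
        ∏ c, (1 + PowerSeries.C (x (i.succAbove c)) * PowerSeries.X))
      = j * ∑ T ∈ Finset.powersetCard j Finset.univ, ∏ c ∈ T, x c := by
  have : (∑ i, PowerSeries.C (x i) * PowerSeries.X *
        ∏ c, (1 + PowerSeries.C (x (i.succAbove c)) * PowerSeries.X))
      = PowerSeries.derivative S (∏ c, (1 + PowerSeries.C (x c) * PowerSeries.X)) * PowerSeries.X := by
    rw [smAux_deriv, Finset.sum_mul]
    refine Finset.sum_congr rfl fun i _ => ?_
    ring
  rw [this]
  cases j with
  | zero => simp
  | succ j =>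
    rw [PowerSeries.coeff_succ_mul_X, PowerSeries.coeff_derivative, smAux_coeff_prod]
    push_cast
    ring

theorem smAux_scale {S : Type*} [CommRing S] {n : ℕ} (t : S) (x : Fin n → S) (j : ℕ) :
    ∑ T ∈ Finset.powersetCard j Finset.univ, ∏ c ∈ T, (t * x c)
      = t ^ j * ∑ T ∈ Finset.powersetCard j Finset.univ, ∏ c ∈ T, x c := by
  rw [Finset.mul_sum]
  refine Finset.sum_congr rfl fun T hT => ?_
  rw [Finset.prod_mul_distrib, Finset.prod_const, (Finset.mem_powersetCard.mp hT).2]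

/-- weights of paths -/
theorem smAux_pow {S : Type*} [CommRing S] {k : ℕ} (B : Matrix (Fin k) (Fin k) S) (n : ℕ)
    (a b : Fin k) :
    (B ^ n) a b = ∑ w : Fin (n+1) → Fin k,
      if w 0 = a ∧ w (Fin.last n) = b then ∏ i : Fin n, B (w i.castSucc) (w i.succ) else 0 := by
  induction n generalizing a with
  | zero =>
    rw [← (Equiv.funUnique (Fin 1) (Fin k)).symm.sum_comp]
    simp [Matrix.one_apply, Fin.last, Finset.filter_and, Finset.filter_eq']
    split_ifs <;> simp_all
  | succ n ih =>
    have hcons : ∀ f : (Fin (n+2) → Fin k) → S,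
        ∑ w, f w = ∑ a : Fin k, ∑ w : Fin (n+1) → Fin k, f (Fin.cons a w) := by
      intro f
      rw [← (Fin.consEquiv (fun _ => Fin k)).sum_comp, Fintype.sum_prod_type]
      rfl
    rw [pow_succ', Matrix.mul_apply, hcons]
    simp only [Fin.cons_zero, Fin.prod_univ_succ, Fin.castSucc_zero,
      ← Fin.succ_last, Fin.cons_succ, Fin.castSucc_succ]
    symm
    rw [Finset.sum_eq_single a]
    · symm
      simp only [true_and]
      simp_rw [ih, Finset.mul_sum]
      rw [Finset.sum_comm]
      refine Finset.sum_congr rfl fun w _ => ?_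
      rw [Finset.sum_eq_single (w 0)]
      · simp
      · intro c _ hc
        simp [hc.symm]
      · simp
    · intro c _ hc
      simp [hc]
    · simp

/-- step weights -/
def smAuxB {S : Type*} [CommRing S] {n : ℕ} (t : S) (x : Fin n → S) : Matrix (Fin n) (Fin n) S :=
  Matrix.of fun i j => (if i = j then 0 else if i < j then 1 else t) * x j

theorem smAux_desc {n k : ℕ} (w : Fin (n+1) → Fin k) :
    desc w = (Finset.univ.filter fun i : Fin n => w i.succ < w i.castSucc).card := by
  classical
  unfold desc
  symm
  refine Finset.card_bij (fun i _ => i.castSucc) ?_ ?_ ?_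
  · intro i hi
    simp only [Finset.mem_filter, Finset.mem_univ, true_and] at hi ⊢
    exact ⟨by simp, hi⟩
  · intro i _ j _ h
    exact Fin.castSucc_injective _ h
  · intro i hi
    simp only [Finset.mem_filter, Finset.mem_univ, true_and] at hi
    obtain ⟨h, h'⟩ := hi
    refine ⟨⟨i, by omega⟩, ?_, rfl⟩
    simp only [Finset.mem_filter, Finset.mem_univ, true_and]
    exact h'

theorem smAux_smirnov {n k : ℕ} (w : Fin (n+1) → Fin k) :
    IsSmirnov w ↔ ∀ i : Fin n, w i.castSucc ≠ w i.succ := by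
  constructor
  · intro h i
    exact (h i.castSucc (by simp)).symm
  · intro h i hi
    exact (h ⟨i, by omega⟩).symm

theorem smAux_weight {S : Type*} [CommRing S] {n k : ℕ} (t : S) (x : Fin k → S)
    (w : Fin (n+1) → Fin k) [Decidable (IsSmirnov w)] :
    x (w 0) * ∏ i : Fin n, smAuxB t x (w i.castSucc) (w i.succ)
      = if IsSmirnov w then t ^ desc w * ∏ i, x (w i) else 0 := by
  split_ifs with h
  · rw [smAux_smirnov] at h
    simp only [smAuxB, Matrix.of_apply]
    rw [Finset.prod_mul_distrib, Fin.prod_univ_succ, smAux_desc, ← Finset.prod_const,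
      Finset.prod_filter]
    have : ∀ i : Fin n, (if w i.castSucc = w i.succ then (0:S)
        else if w i.castSucc < w i.succ then 1 else t)
        = if w i.succ < w i.castSucc then t else 1 := by
      intro i
      rw [if_neg (h i)]
      rcases lt_or_gt_of_ne (h i) with h1 | h1
      · rw [if_pos h1, if_neg h1.not_gt]
      · rw [if_neg h1.not_gt, if_pos h1]
    simp_rw [this]
    ring
  · rw [smAux_smirnov] at h
    push Not at h
    obtain ⟨i, hi⟩ := h
    rw [Finset.prod_eq_zero (Finset.mem_univ i), mul_zero]
    simp [smAuxB, hi]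

theorem smAux_trace {n k : ℕ} :
    ∑ i, Polynomial.C (MvPolynomial.X i) *
      ((smAuxB (Polynomial.X : Polynomial (MvPolynomial (Fin k) ℤ))
        (fun c => Polynomial.C (MvPolynomial.X c))) ^ n) i i
      = smirnovEnum ℤ (n+1) k desc FirstEqLast := by
  classical
  unfold smirnovEnum
  simp_rw [smAux_pow, Finset.mul_sum]
  rw [Finset.sum_comm, Finset.sum_filter]
  refine Finset.sum_congr rfl fun w _ => ?_
  have hP : FirstEqLast w ↔ w (Fin.last n) = w 0 :=
    ⟨fun ⟨_, h⟩ => h.symm, fun h => ⟨n.succ_pos, h.symm⟩⟩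
  rw [Finset.sum_eq_single (w 0)]
  · simp only [true_and, mul_ite, mul_zero]
    have := smAux_weight (Polynomial.X : Polynomial (MvPolynomial (Fin k) ℤ))
      (fun c => Polynomial.C (MvPolynomial.X c)) w
    rw [this, xw, map_prod]
    by_cases h1 : IsSmirnov w <;> by_cases h2 : w (Fin.last n) = w 0 <;> simp [h1, h2, hP]
  · intro c _ hc
    simp [hc.symm]
  · simp

theorem smAux_inv {S : Type*} [CommRing S] {k : ℕ} (t : S) (x : Fin k → S) :
    smAuxM (PowerSeries.C t) (fun c => PowerSeries.C (x c) * PowerSeries.X) *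
      (Matrix.of fun i j => PowerSeries.mk fun n => (smAuxB t x ^ n) i j) = 1 := by
  have hM : smAuxM (PowerSeries.C t) (fun c => PowerSeries.C (x c) * PowerSeries.X)
      = 1 - Matrix.of fun i j => PowerSeries.C (smAuxB t x i j) * PowerSeries.X := by
    ext1 i j
    simp only [smAuxM, smAuxB, Matrix.of_apply, Matrix.sub_apply, Matrix.one_apply]
    split_ifs <;> simp [mul_assoc]
  rw [hM, sub_mul, one_mul]
  ext i j n
  simp only [Matrix.sub_apply, Matrix.of_apply, Matrix.mul_apply, map_sub, map_sum,
    PowerSeries.coeff_mk, mul_assoc, PowerSeries.coeff_C_mul, Matrix.one_apply]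
  cases n with
  | zero => 
    simp only [PowerSeries.coeff_zero_X_mul, pow_zero, Matrix.one_apply]
    split_ifs <;> simp
  | succ n =>
    simp only [PowerSeries.coeff_succ_X_mul, PowerSeries.coeff_mk, pow_succ', Matrix.mul_apply]
    split_ifs <;> simp [PowerSeries.coeff_one]

theorem smAux_diag {S : Type*} [CommRing S] {k : ℕ} (t : S) (x : Fin (k+1) → S) (i : Fin (k+1)) :
    (smAuxM (PowerSeries.C t) (fun c => PowerSeries.C (x c) * PowerSeries.X)).det *
      PowerSeries.mk (fun n => (smAuxB t x ^ n) i i)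
     = (smAuxM (PowerSeries.C t)
        (fun c => PowerSeries.C (x (i.succAbove c)) * PowerSeries.X)).det := by
  have h := congrArg (fun N => Matrix.adjugate
    (smAuxM (PowerSeries.C t) (fun c => PowerSeries.C (x c) * PowerSeries.X)) * N) (smAux_inv t x)
  simp only [← mul_assoc, Matrix.adjugate_mul, mul_one, Matrix.smul_mul, one_mul] at h
  have h2 := congrFun (congrFun h i) i
  simp only [Matrix.smul_apply, Matrix.of_apply, smul_eq_mul] at h2
  rw [h2, Matrix.adjugate_fin_succ_eq_det_submatrix, ← two_mul, pow_mul]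
  simp only [even_two, Even.neg_pow, one_pow, one_mul]
  congr 1
  ext1 a b
  simp [smAuxM, Fin.succAbove_lt_succAbove_iff]

theorem smAux_geom {S : Type*} [CommRing S] (t : S) (m : ℕ) :
    (1 - t) * ∑ j ∈ Finset.range m, t ^ j = 1 - t ^ m := by
  exact mul_neg_geom_sum t m

theorem smAux_X_ne {k : ℕ} : (Polynomial.X : Polynomial (MvPolynomial (Fin k) ℤ)) ≠ 1 := by
  intro h
  have := congrArg (Polynomial.eval 0) h
  simp at this

theorem smAux_D (k : ℕ) :
    Dser ℤ k = (smAuxM (PowerSeries.C Polynomial.X)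
      (fun c : Fin k => PowerSeries.C (Polynomial.C (MvPolynomial.X c)) * PowerSeries.X)).det := by
  have hne : (PowerSeries.C (1 - Polynomial.X : Polynomial (MvPolynomial (Fin k) ℤ))) ≠ 0 := by
    rw [Ne, map_eq_zero_iff _ PowerSeries.C_injective, sub_eq_zero]
    exact fun h => smAux_X_ne h.symm
  apply mul_left_cancel₀ hne
  have h := smAux_det (PowerSeries.C (Polynomial.X : Polynomial (MvPolynomial (Fin k) ℤ)))
      (fun c : Fin k => PowerSeries.C (Polynomial.C (MvPolynomial.X c)) * PowerSeries.X)
  rw [map_sub, map_one, h]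
  simp only [← mul_assoc, ← map_mul]
  rw [← map_one PowerSeries.C, ← map_sub, map_one]
  ext1 j
  rw [PowerSeries.coeff_C_mul, map_sub, PowerSeries.coeff_C_mul, smAux_coeff_prod, smAux_coeff_prod,
    smAux_scale, Dser, PowerSeries.coeff_mk]
  have he : ∑ T ∈ Finset.powersetCard j Finset.univ, ∏ c ∈ T,
      (Polynomial.C (MvPolynomial.X c) : Polynomial (MvPolynomial (Fin k) ℤ))
      = Polynomial.C (esymm (Fin k) ℤ j) := by
    simp [esymm]
  rw [he]
  rcases j with _ | _ | j
  · simp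
  · simp
  · have := smAux_geom (Polynomial.X : Polynomial (MvPolynomial (Fin k) ℤ)) (j+1)
    simp only [tnum, Nat.add_eq_zero_iff, one_ne_zero, and_false, if_false, Nat.add_eq_right,
      Nat.add_sub_cancel]
    linear_combination (- Polynomial.X * Polynomial.C (esymm (Fin k) ℤ (j+2))) * this

theorem smAux_N (k : ℕ) :
    ∑ i : Fin (k+1), PowerSeries.C (Polynomial.C (MvPolynomial.X i)) * PowerSeries.X *
     (smAuxM (PowerSeries.C (Polynomial.X : Polynomial (MvPolynomial (Fin (k+1)) ℤ)))
        (fun c => PowerSeries.C (Polynomial.C (MvPolynomial.X (i.succAbove c))) * PowerSeries.X)).det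
    = PowerSeries.mk (fun i =>
      if i = 0 then 0
      else if i = 1 then Polynomial.C (esymm (Fin (k+1)) ℤ 1)
      else -((i : Polynomial (MvPolynomial (Fin (k+1)) ℤ)) * Polynomial.X * tnum ℤ (k+1) (i - 2) *
          Polynomial.C (esymm (Fin (k+1)) ℤ i))) := by
  have hne : (PowerSeries.C (Polynomial.X * (1 - Polynomial.X) :
      Polynomial (MvPolynomial (Fin (k+1)) ℤ))) ≠ 0 := by
    rw [Ne, map_eq_zero_iff _ PowerSeries.C_injective, mul_eq_zero, not_or, sub_eq_zero]
    exact ⟨Polynomial.X_ne_zero, fun h => smAux_X_ne h.symm⟩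
  apply mul_left_cancel₀ hne
  have key : ∀ i : Fin (k+1), PowerSeries.C (Polynomial.X * (1 - Polynomial.X)) *
     (PowerSeries.C (Polynomial.C (MvPolynomial.X i)) * PowerSeries.X *
     (smAuxM (PowerSeries.C (Polynomial.X : Polynomial (MvPolynomial (Fin (k+1)) ℤ)))
        (fun c => PowerSeries.C (Polynomial.C (MvPolynomial.X (i.succAbove c))) *
          PowerSeries.X)).det)
     = PowerSeries.C (Polynomial.X * Polynomial.C (MvPolynomial.X i)) * PowerSeries.X *
        ∏ c, (1 + PowerSeries.C (Polynomial.X * Polynomial.C (MvPolynomial.X (i.succAbove c))) *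
          PowerSeries.X)
      - PowerSeries.C (Polynomial.X ^ 2 : Polynomial (MvPolynomial (Fin (k+1)) ℤ)) *
       (PowerSeries.C (Polynomial.C (MvPolynomial.X i)) * PowerSeries.X *
        ∏ c, (1 + PowerSeries.C (Polynomial.C (MvPolynomial.X (i.succAbove c))) *
          PowerSeries.X)) := by
    intro i
    have h := smAux_det (PowerSeries.C (Polynomial.X : Polynomial (MvPolynomial (Fin (k+1)) ℤ)))
      (fun c => PowerSeries.C (Polynomial.C (MvPolynomial.X (i.succAbove c))) * PowerSeries.X)
    simp only [← mul_assoc, ← map_mul] at h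
    simp only [map_mul, map_sub, map_one, map_pow] at h ⊢
    linear_combination (PowerSeries.C Polynomial.X *
      PowerSeries.C (Polynomial.C (MvPolynomial.X i)) * PowerSeries.X) * h
  rw [Finset.mul_sum, Finset.sum_congr rfl fun i _ => key i, Finset.sum_sub_distrib,
    ← Finset.mul_sum]
  ext1 j
  rw [PowerSeries.coeff_C_mul, map_sub, PowerSeries.coeff_C_mul,
    smAux_coeff_sum (fun c => (Polynomial.X : Polynomial (MvPolynomial (Fin (k+1)) ℤ)) * Polynomial.C (MvPolynomial.X c)),
    smAux_coeff_sum (fun c => (Polynomial.C (MvPolynomial.X c) : Polynomial (MvPolynomial (Fin (k+1)) ℤ))),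
    smAux_scale, PowerSeries.coeff_mk]
  have he : ∑ T ∈ Finset.powersetCard j Finset.univ, ∏ c ∈ T,
      (Polynomial.C (MvPolynomial.X c) : Polynomial (MvPolynomial (Fin (k+1)) ℤ))
      = Polynomial.C (esymm (Fin (k+1)) ℤ j) := by
    simp [esymm]
  rw [he]
  rcases j with _ | _ | j
  · simp
  · simp
    ring
  · have := smAux_geom (Polynomial.X : Polynomial (MvPolynomial (Fin (k+1)) ℤ)) j
    simp only [tnum, Nat.add_eq_zero_iff, one_ne_zero, and_false, if_false, Nat.add_eq_right,
      Nat.add_sub_cancel]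
    push_cast
    linear_combination (Polynomial.X ^ 2 * ((j : Polynomial (MvPolynomial (Fin (k+1)) ℤ)) + 1 + 1) *
      Polynomial.C (esymm (Fin (k+1)) ℤ (j+2))) * this

theorem smAux_main (k : ℕ) :
    Dser ℤ (k+1) *
      PowerSeries.mk (fun n => if n = 0 then 0 else smirnovEnum ℤ n (k+1) desc FirstEqLast) =
    PowerSeries.mk (fun i =>
      if i = 0 then 0
      else if i = 1 then Polynomial.C (esymm (Fin (k+1)) ℤ 1)
      else -((i : Polynomial (MvPolynomial (Fin (k+1)) ℤ)) * Polynomial.X * tnum ℤ (k+1) (i - 2) *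
          Polynomial.C (esymm (Fin (k+1)) ℤ i))) := by
  rw [← smAux_N]
  have hW : PowerSeries.mk (fun n => if n = 0 then 0 else
        smirnovEnum ℤ n (k+1) desc FirstEqLast)
      = ∑ i : Fin (k+1), PowerSeries.C (Polynomial.C (MvPolynomial.X i)) * PowerSeries.X *
        PowerSeries.mk (fun n => ((smAuxB (Polynomial.X : Polynomial (MvPolynomial (Fin (k+1)) ℤ))
        (fun c => Polynomial.C (MvPolynomial.X c))) ^ n) i i) := by
    ext1 n
    simp only [map_sum, mul_assoc, PowerSeries.coeff_C_mul, PowerSeries.coeff_mk]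
    cases n with
    | zero => simp
    | succ n =>
      simp only [PowerSeries.coeff_succ_X_mul, PowerSeries.coeff_mk, smAux_trace]
      simp
  rw [hW, Finset.mul_sum]
  refine Finset.sum_congr rfl fun i _ => ?_
  have h := smAux_diag (Polynomial.X : Polynomial (MvPolynomial (Fin (k+1)) ℤ))
    (fun c => Polynomial.C (MvPolynomial.X c)) i
  rw [← h, smAux_D]
  ring

end helpers

/-- `D(x,t,z) · Σ_{n≥1} W_n^=(x,t) z^n = e_1(x) z - Σ_{i≥2} i·t[i-2]_t e_i(x) z^i`. -/
theorem smirnov_eq_enumerator (k : ℕ) (hk : 1 ≤ k) :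
    Dser ℤ k *
      PowerSeries.mk (fun n => if n = 0 then 0 else smirnovEnum ℤ n k desc FirstEqLast) =
    PowerSeries.mk (fun i =>
      if i = 0 then 0
      else if i = 1 then Polynomial.C (esymm (Fin k) ℤ 1)
      else -((i : Polynomial (MvPolynomial (Fin k) ℤ)) * Polynomial.X * tnum ℤ k (i - 2) *
          Polynomial.C (esymm (Fin k) ℤ i))) := by
  obtain ⟨m, rfl⟩ : ∃ m, k = m + 1 := ⟨k - 1, by omega⟩
  convert smAux_main m

end
end

section
/- For all n ≥ 1 and k ≥ 1, the polynomials W_n^<(x,t) := Σ_w t^{des(w)} x_w (sum over Smirnov words w of length n over [k] with w_1 < w_n) and W_n^>(x,t) := Σ_w t^{des(w)} x_w (sum over Smirnov words w of length n over [k] with w_1 > w_n) are symmetric in the variables x_1,…,x_k and are e-positive. -/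
open Finset MvPolynomial Polynomial

attribute [local instance] Classical.propDecidable

noncomputable section

/-- e-positivity of a symmetric polynomial in `x₁,…,x_k` (no `t`): it is a nonnegative
combination of products `e_λ = e_{λ₁}⋯e_{λ_ℓ}` over partitions `λ` (multisets of positive
integers). -/
def EPosX (R : Type) [CommRing R] [PartialOrder R] {k : ℕ} (P : MvPolynomial (Fin k) R) : Prop :=
  ∃ (S : Finset (Multiset ℕ)) (c : Multiset ℕ → R),
    (∀ μ ∈ S, ∀ i ∈ μ, 0 < i) ∧ (∀ μ ∈ S, 0 ≤ c μ) ∧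
    P = ∑ μ ∈ S, MvPolynomial.C (c μ) * (μ.map (esymm (Fin k) R)).prod

/-- e-positivity of a polynomial in `t` with coefficients in `R[x₁,…,x_k]`:
`P = Σ_λ c_λ(t) e_λ(x)` over partitions `λ`, where each `c_λ(t)` has nonnegative
coefficients. -/
def EPosT (R : Type) [CommRing R] [PartialOrder R] {k : ℕ}
    (P : Polynomial (MvPolynomial (Fin k) R)) : Prop :=
  ∃ (S : Finset (Multiset ℕ)) (c : Multiset ℕ → Polynomial R),
    (∀ μ ∈ S, ∀ i ∈ μ, 0 < i) ∧ (∀ μ ∈ S, ∀ j, 0 ≤ (c μ).coeff j) ∧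
    P = ∑ μ ∈ S, ((c μ).map (MvPolynomial.C : R →+* MvPolynomial (Fin k) R)) *
          Polynomial.C ((μ.map (esymm (Fin k) R)).prod)

/-- `P`, a polynomial in `t` with coefficients in `R[x₁,…,x_k]`, is symmetric in
`x₁,…,x_k`. -/
def SymmX (R : Type) [CommRing R] {k : ℕ} (P : Polynomial (MvPolynomial (Fin k) R)) : Prop :=
  ∀ j : ℕ, (P.coeff j).IsSymmetric

/-- The matrix `1 - (sL + tLᵀ) diag(y)`. -/
def Nm {B : Type*} [CommRing B] {k : ℕ} (s t : B) (y : Fin k → B) : Matrix (Fin k) (Fin k) B :=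
  Matrix.of fun i j => if i = j then 1 else if i < j then -(s * y j) else -(t * y j)

/-- rank one updates of a determinant are affine -/
lemma det_affine {B : Type*} [CommRing B] {k : ℕ} (N : Matrix (Fin k) (Fin k) B) (y : Fin k → B) :
    ∃ g : B, ∀ c : B, (N + Matrix.of fun _ j => c * y j).det = N.det + c * g := by
  let F : Matrix (Unit ⊕ Fin k) (Unit ⊕ Fin k) B :=
    Matrix.fromBlocks 1 0 (Matrix.of fun _ _ => 1) N
  refine ⟨(F.updateRow (Sum.inl ()) (Sum.elim (0 : Unit → B) (fun j => - y j))).det, fun c => ?_⟩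
  have h1 : N.det = F.det := by
    simp [F, Matrix.det_fromBlocks_zero₁₂]
  have h2 : (N + Matrix.of fun _ j => c * y j).det =
      (F.updateRow (Sum.inl ()) (Sum.elim (1 : Unit → B) (0 : Fin k → B) + c • (Sum.elim (0 : Unit → B) (fun j => - y j)))).det := by
    have : (F.updateRow (Sum.inl ()) (Sum.elim (1 : Unit → B) (0 : Fin k → B) + c • (Sum.elim (0 : Unit → B) (fun j => - y j)))) =
        Matrix.fromBlocks 1 (Matrix.of fun _ j => - (c * y j)) (Matrix.of fun _ _ => 1) N := by
      ext i j
      rcases i with i | i <;> rcases j with j | j <;> simp [F, Matrix.updateRow_apply]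
    rw [this, Matrix.det_fromBlocks_one₁₁]
    congr 1
    ext i j
    simp [Matrix.mul_apply]
  rw [h2, Matrix.det_updateRow_add, Matrix.det_updateRow_smul, h1]
  congr 2
  ext i j
  rcases i with i | i <;> rcases j with j | j <;> simp [F, Matrix.updateRow_apply]

lemma det_Nm_mul {B : Type*} [CommRing B] {k : ℕ} (s t : B) (y : Fin k → B) :
    (s - t) * (Nm s t y).det = s * ∏ i, (1 + t * y i) - t * ∏ i, (1 + s * y i) := by
  obtain ⟨g, hg⟩ := det_affine (Nm s t y) y
  have hs : (Nm s t y + Matrix.of fun _ j => s * y j).det = ∏ i, (1 + s * y i) := by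
    rw [Matrix.det_of_isLowerTriangular]
    · simp [Nm]
    · intro i j hij
      have : i < j := hij
      simp [Nm, this, this.ne]
  have ht : (Nm s t y + Matrix.of fun _ j => t * y j).det = ∏ i, (1 + t * y i) := by
    rw [Matrix.det_of_isUpperTriangular]
    · simp [Nm]
    · intro i j hij
      have : j < i := hij
      simp [Nm, this.not_gt, this.ne']
  rw [hg] at hs ht
  rw [← hs, ← ht]
  ring

/-- elementary symmetric function of a family -/
def El {B : Type*} [CommRing B] {k : ℕ} (y : Fin k → B) (i : ℕ) : B :=
  ∑ S ∈ Finset.powersetCard i (Finset.univ : Finset (Fin k)), ∏ j ∈ S, y j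

lemma prod_El {B : Type*} [CommRing B] {k : ℕ} (y : Fin k → B) (c : B) :
    ∏ i, (1 + c * y i) = ∑ i ∈ Finset.range (k + 1), c ^ i * El y i := by
  rw [Finset.prod_one_add, Finset.sum_powerset]
  simp only [Finset.card_univ, Fintype.card_fin, El, Finset.mul_sum]
  refine Finset.sum_congr rfl fun i _ => Finset.sum_congr rfl fun S hS => ?_
  rw [Finset.prod_mul_distrib, Finset.prod_const, (Finset.mem_powersetCard.1 hS).2]

/-- `st · h_{i-2}(s,t)` -/
def hh {B : Type*} [CommRing B] (s t : B) (i : ℕ) : B :=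
  s * t * ∑ j ∈ Finset.range (i - 1), s ^ j * t ^ (i - 1 - 1 - j)

lemma hh_mul {B : Type*} [CommRing B] (s t : B) (i : ℕ) :
    (s - t) * hh s t (i + 1) = t * s ^ (i + 1) - s * t ^ (i + 1) := by
  have := geom_sum₂_mul s t i
  simp only [hh, Nat.add_sub_cancel]
  linear_combination s * t * this

lemma det_Nm {B : Type*} [CommRing B] [IsDomain B] {k : ℕ} (s t : B) (hst : s ≠ t)
    (y : Fin k → B) :
    (Nm s t y).det = 1 - ∑ i ∈ Finset.range (k + 1), El y i * hh s t i := by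
  apply mul_left_cancel₀ (sub_ne_zero.2 hst)
  rw [det_Nm_mul, prod_El, prod_El, mul_sub, Finset.sum_range_succ', Finset.sum_range_succ',
    Finset.sum_range_succ' (fun i => El y i * hh s t i)]
  have h0 : hh s t 0 = 0 := by simp [hh]
  have h1 : El y 0 = 1 := by simp [El]
  rw [h0, h1]
  have : (s - t) * ∑ i ∈ Finset.range k, El y (i+1) * hh s t (i+1) =
     t * ∑ i ∈ Finset.range k, s^(i+1) * El y (i+1) - s * ∑ i ∈ Finset.range k, t^(i+1) * El y (i+1) := by
    rw [Finset.mul_sum, Finset.mul_sum, Finset.mul_sum, ← Finset.sum_sub_distrib]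
    refine Finset.sum_congr rfl fun i _ => ?_
    linear_combination El y (i+1) * hh_mul s t i
  linear_combination this

/-- Jacobi's formula, for an invertible matrix -/
lemma jacobi {R : Type*} [CommRing R] {k : ℕ} (N G P : Matrix (Fin k) (Fin k) R)
    (h : N * G = 1) :
    (N.map Polynomial.C + (Polynomial.X : R[X]) • P.map Polynomial.C).det.coeff 1 =
      N.det * (G * P).trace := by
  have : N.map Polynomial.C + (Polynomial.X : R[X]) • P.map Polynomial.C =
      N.map Polynomial.C * (1 + (Polynomial.X : R[X]) • (G * P).map Polynomial.C) := by
    rw [Matrix.mul_add, Matrix.mul_one, Matrix.mul_smul, ← Matrix.map_mul, ← Matrix.mul_assoc, h,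
      Matrix.one_mul]
  rw [this, Matrix.det_mul]
  have h2 : (N.map (Polynomial.C : R →+* R[X])).det = Polynomial.C N.det :=
    (RingHom.map_det Polynomial.C N).symm
  rw [h2, Polynomial.coeff_C_mul, Matrix.coeff_det_one_add_X_smul_one]

lemma det_coeff_zero {R : Type*} [CommRing R] {k : ℕ} (N P : Matrix (Fin k) (Fin k) R) :
    (N.map Polynomial.C + (Polynomial.X : R[X]) • P.map Polynomial.C).det.coeff 0 = N.det := by
  rw [Polynomial.coeff_zero_eq_eval_zero, ← Polynomial.coe_evalRingHom, RingHom.map_det]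
  congr 1
  ext i j
  simp

/-- geometric series of a matrix, as a matrix of power series -/
def Gm {A : Type*} [CommRing A] {k : ℕ} (M : Matrix (Fin k) (Fin k) A) :
    Matrix (Fin k) (Fin k) (PowerSeries A) :=
  Matrix.of fun i j => PowerSeries.mk fun n => (M ^ n) i j

lemma Gm_mul {A : Type*} [CommRing A] {k : ℕ} (M : Matrix (Fin k) (Fin k) A) :
    (1 - (PowerSeries.X : PowerSeries A) • M.map (PowerSeries.C (R := A))) * Gm M = 1 := by
  rw [Matrix.sub_mul, Matrix.one_mul, Matrix.smul_mul]
  ext i j n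
  simp only [Matrix.sub_apply, Matrix.smul_apply, Matrix.mul_apply, smul_eq_mul, map_sub]
  rcases n with _ | n
  · simp [Gm, Matrix.one_apply]
  · rw [PowerSeries.coeff_succ_X_mul]
    simp only [Gm, Matrix.of_apply, PowerSeries.coeff_mk, map_sum, Matrix.map_apply,
      PowerSeries.coeff_C_mul]
    rw [pow_succ', Matrix.mul_apply, sub_self, Matrix.one_apply]
    split_ifs <;> simp [PowerSeries.coeff_one]

/-- transfer matrix -/
def Mt {A : Type*} [CommRing A] {k : ℕ} (s t : A) (x : Fin k → A) : Matrix (Fin k) (Fin k) A :=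
  Matrix.of fun i j => if i = j then 0 else if i < j then s * x j else t * x j

/-- generating function of the cyclic traces -/
def Vs {A : Type*} [CommRing A] {k : ℕ} (M Q : Matrix (Fin k) (Fin k) A) : PowerSeries A :=
  PowerSeries.X * (Gm M * Q.map (PowerSeries.C (R := A))).trace

lemma coeff_Vs {A : Type*} [CommRing A] {k : ℕ} (M Q : Matrix (Fin k) (Fin k) A) (n : ℕ) :
    PowerSeries.coeff (n + 1) (Vs M Q) = (M ^ n * Q).trace := by
  rw [Vs, PowerSeries.coeff_succ_X_mul]
  simp [Matrix.trace, Matrix.mul_apply, Gm, PowerSeries.coeff_mul_C]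

lemma El_smul {A : Type*} [CommRing A] {k : ℕ} (x : Fin k → A) (i : ℕ) :
    El (fun j => (Polynomial.C (PowerSeries.X * PowerSeries.C (x j)) : (PowerSeries A)[X])) i =
      Polynomial.C (PowerSeries.X ^ i * PowerSeries.C (El x i)) := by
  simp only [El, map_sum, Finset.mul_sum]
  refine Finset.sum_congr rfl fun S hS => ?_
  rw [← map_prod, Finset.prod_mul_distrib, Finset.prod_const, (Finset.mem_powersetCard.1 hS).2,
    map_prod]

lemma hh_map {A B : Type*} [CommRing A] [CommRing B] (φ : A →+* B) (s t : A) (i : ℕ) :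
    hh (φ s) (φ t) i = φ (hh s t i) := by
  simp [hh]

lemma det_coeffs {A : Type*} [CommRing A] [IsDomain A] {k : ℕ} (x : Fin k → A) (T α β : A)
    (hT : T ≠ 1) (m : ℕ) :
    (((1 - (PowerSeries.X : PowerSeries A) • (Mt 1 T x).map (PowerSeries.C (R := A))).map
        Polynomial.C +
      (Polynomial.X : (PowerSeries A)[X]) •
        (-((PowerSeries.X : PowerSeries A) • (Mt α β x).map (PowerSeries.C (R := A)))).map
          Polynomial.C).det).coeff m =
    (1 : (PowerSeries A)[X]).coeff m - ∑ i ∈ Finset.range (k + 1), PowerSeries.X ^ i *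
      PowerSeries.C (El x i * (hh (1 + Polynomial.C α * Polynomial.X)
        (Polynomial.C T + Polynomial.C β * Polynomial.X) i).coeff m) := by
  let φ : A[X] →+* (PowerSeries A)[X] := Polynomial.mapRingHom (PowerSeries.C (R := A))
  let s : A[X] := 1 + Polynomial.C α * Polynomial.X
  let t : A[X] := Polynomial.C T + Polynomial.C β * Polynomial.X
  have hst : φ s ≠ φ t := by
    intro h
    have h2 := congrArg (fun p => PowerSeries.constantCoeff (Polynomial.coeff p 0)) h
    simp [φ, s, t] at h2
    exact hT h2.symm
  have key := det_Nm (φ s) (φ t) hst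
    (fun j => (Polynomial.C (PowerSeries.X * PowerSeries.C (x j)) : (PowerSeries A)[X]))
  have e : Nm (φ s) (φ t)
    (fun j => (Polynomial.C (PowerSeries.X * PowerSeries.C (x j)) : (PowerSeries A)[X])) =
    (1 - (PowerSeries.X : PowerSeries A) • (Mt 1 T x).map (PowerSeries.C (R := A))).map
        Polynomial.C +
      (Polynomial.X : (PowerSeries A)[X]) •
        (-((PowerSeries.X : PowerSeries A) • (Mt α β x).map (PowerSeries.C (R := A)))).map
          Polynomial.C := by
    refine Matrix.ext fun i j => ?_
    simp only [Nm, Mt, Matrix.of_apply, Matrix.add_apply, Matrix.map_apply, Matrix.smul_apply,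
      Matrix.sub_apply, Matrix.neg_apply, Matrix.one_apply, smul_eq_mul]
    split_ifs
    · simp
    · simp [φ, s]; ring
    · simp [φ, t]; ring
  rw [e] at key
  rw [key, Polynomial.coeff_sub, Polynomial.finsetSum_coeff]
  congr 1
  refine Finset.sum_congr rfl fun i _ => ?_
  rw [El_smul, hh_map, Polynomial.coeff_C_mul, map_mul, ← mul_assoc]
  simp [φ, s, t]

lemma hh_coeff_mem {A : Type*} [CommRing A] (S : Subsemiring A) (T α β : A)
    (hT : T ∈ S) (hα : α ∈ S) (hβ : β ∈ S) (i m : ℕ) :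
    (hh (1 + Polynomial.C α * Polynomial.X)
        (Polynomial.C T + Polynomial.C β * Polynomial.X) i).coeff m ∈ S := by
  have hC : ∀ a ∈ S, Polynomial.C a ∈ Polynomial.lifts S.subtype := fun a ha =>
    Polynomial.C_mem_lifts S.subtype ⟨a, ha⟩
  have hX := Polynomial.X_mem_lifts S.subtype
  have hs : (1 + Polynomial.C α * Polynomial.X) ∈ Polynomial.lifts S.subtype :=
    add_mem (one_mem _) (mul_mem (hC _ hα) hX)
  have ht : (Polynomial.C T + Polynomial.C β * Polynomial.X) ∈ Polynomial.lifts S.subtype :=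
    add_mem (hC _ hT) (mul_mem (hC _ hβ) hX)
  have : hh (1 + Polynomial.C α * Polynomial.X)
        (Polynomial.C T + Polynomial.C β * Polynomial.X) i ∈ Polynomial.lifts S.subtype :=
    mul_mem (mul_mem hs ht) (sum_mem fun j _ => mul_mem (pow_mem hs _) (pow_mem ht _))
  obtain ⟨y, hy⟩ := (Polynomial.lifts_iff_coeff_lifts _).1 this m
  rw [← hy]
  exact y.2

lemma Vs_rec {A : Type*} [CommRing A] [IsDomain A] {k : ℕ} (x : Fin k → A) (T α β : A)
    (hT : T ≠ 1) :
    ∑ i ∈ Finset.range (k + 1), PowerSeries.X ^ i *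
      PowerSeries.C (El x i * (hh (1 + Polynomial.C α * Polynomial.X)
        (Polynomial.C T + Polynomial.C β * Polynomial.X) i).coeff 1) =
    (1 - ∑ i ∈ Finset.range (k + 1), PowerSeries.X ^ i *
      PowerSeries.C (El x i * (hh (1 + Polynomial.C α * Polynomial.X)
        (Polynomial.C T + Polynomial.C β * Polynomial.X) i).coeff 0)) *
      Vs (Mt 1 T x) (Mt α β x) := by
  have h0 := det_coeffs x T α β hT 0
  have h1 := det_coeffs x T α β hT 1
  rw [jacobi _ _ _ (Gm_mul (Mt 1 T x))] at h1
  rw [det_coeff_zero] at h0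
  rw [h0] at h1
  rw [Polynomial.coeff_one_zero] at h1
  have : (Gm (Mt 1 T x) * -((PowerSeries.X : PowerSeries A) •
      (Mt α β x).map (PowerSeries.C (R := A)))).trace = - Vs (Mt 1 T x) (Mt α β x) := by
    rw [Vs, Matrix.mul_neg, Matrix.trace_neg, Matrix.mul_smul, Matrix.trace_smul, smul_eq_mul]
  rw [this] at h1
  have h2 : (1 : (PowerSeries A)[X]).coeff 1 = 0 := by simp [Polynomial.coeff_one]
  rw [h2] at h1
  linear_combination h1

lemma Vs_mem {A : Type*} [CommRing A] [IsDomain A] {k : ℕ} (x : Fin k → A) (T α β : A)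
    (hT1 : T ≠ 1) (S : Subsemiring A) (hT : T ∈ S) (hα : α ∈ S) (hβ : β ∈ S)
    (hE : ∀ i, El x (i + 1) ∈ S) (n : ℕ) :
    PowerSeries.coeff n (Vs (Mt 1 T x) (Mt α β x)) ∈ S := by
  have hE' : ∀ i, El x i ∈ S := by
    rintro (_ | i)
    · simp [El]
    · exact hE i
  have hr := Vs_rec x T α β hT1
  set V := Vs (Mt 1 T x) (Mt α β x) with hV
  set d : ℕ → A := fun i => (hh (1 + Polynomial.C α * Polynomial.X)
        (Polynomial.C T + Polynomial.C β * Polynomial.X) i).coeff 1 with hd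
  set g : ℕ → A := fun i => (hh (1 + Polynomial.C α * Polynomial.X)
        (Polynomial.C T + Polynomial.C β * Polynomial.X) i).coeff 0 with hg
  have hr' : V = ∑ i ∈ Finset.range (k + 1), PowerSeries.X ^ i * PowerSeries.C (El x i * d i) +
      ∑ i ∈ Finset.range (k + 1), PowerSeries.X ^ i * (PowerSeries.C (El x i * g i) * V) := by
    simp_rw [← mul_assoc]
    rw [← Finset.sum_mul]
    linear_combination -hr
  induction n using Nat.strong_induction_on with
  | _ n ih =>
    rw [hr', map_add, map_sum, map_sum]
    refine add_mem (sum_mem fun i _ => ?_) (sum_mem fun i _ => ?_)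
    · rw [PowerSeries.coeff_X_pow_mul']
      split_ifs
      · rw [PowerSeries.coeff_C]
        split_ifs
        · exact mul_mem (hE' _) (hh_coeff_mem S T α β hT hα hβ _ _)
        · exact zero_mem _
      · exact zero_mem _
    · rw [PowerSeries.coeff_X_pow_mul']
      split_ifs with hi
      · rw [PowerSeries.coeff_C_mul]
        rcases Nat.eq_zero_or_pos i with rfl | hi0
        · simp [hg, hh]
        · exact mul_mem (mul_mem (hE' _) (hh_coeff_mem S T α β hT hα hβ _ _)) (ih _ (by omega))
      · exact zero_mem _

/-- sums over words as matrix powers -/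
lemma word_sum {A : Type*} [CommRing A] {k : ℕ} (M : Matrix (Fin k) (Fin k) A) (n : ℕ)
    (F : Fin k → Fin k → A) :
    ∑ w : Fin (n + 1) → Fin k, F (w 0) (w (Fin.last n)) *
      ∏ i : Fin n, M (w i.castSucc) (w i.succ) = ∑ a, ∑ b, F a b * (M ^ n) a b := by
  induction n generalizing F with
  | zero =>
    rw [← (Equiv.funUnique (Fin 1) (Fin k)).symm.sum_comp]
    simp [Matrix.one_apply]
  | succ n ih =>
    rw [← (Fin.consEquiv (fun _ => Fin k)).sum_comp, Fintype.sum_prod_type]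
    have h : ∀ a, ∑ w : Fin (n + 1) → Fin k,
        F ((Fin.consEquiv (fun _ => Fin k)) (a, w) 0)
          ((Fin.consEquiv (fun _ => Fin k)) (a, w) (Fin.last (n+1))) *
        ∏ i : Fin (n+1), M ((Fin.consEquiv (fun _ => Fin k)) (a, w) i.castSucc)
          ((Fin.consEquiv (fun _ => Fin k)) (a, w) i.succ) =
        ∑ c, ∑ b, (F a b * M a c) * (M ^ n) c b := by
      intro a
      rw [← ih (fun c b => F a b * M a c)]
      refine Finset.sum_congr rfl fun w _ => ?_
      rw [Fin.prod_univ_succ]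
      simp only [Fin.consEquiv_apply, Fin.cons_zero, Fin.castSucc_zero, Fin.cons_succ,
        ← Fin.succ_castSucc, ← Fin.succ_last]
      ring
    rw [Finset.sum_congr rfl fun a _ => h a]
    refine Finset.sum_congr rfl fun a _ => ?_
    rw [Finset.sum_comm]
    refine Finset.sum_congr rfl fun b _ => ?_
    rw [pow_succ', Matrix.mul_apply, Finset.mul_sum]
    refine Finset.sum_congr rfl fun c _ => ?_
    ring

lemma desc_succ {n k : ℕ} (w : Fin (n + 1) → Fin k) :
    desc w = ∑ i : Fin n, if w i.succ < w i.castSucc then 1 else 0 := by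
  unfold desc
  rw [Finset.card_filter, Fin.sum_univ_castSucc, if_neg (by simp), add_zero]
  refine Finset.sum_congr rfl fun i _ => ?_
  have : (∃ h : (i.castSucc : ℕ) + 1 < n + 1, w ⟨(i.castSucc : ℕ) + 1, h⟩ < w i.castSucc) ↔
      w i.succ < w i.castSucc := by
    constructor
    · rintro ⟨h, h'⟩
      exact h'
    · intro h
      exact ⟨by simp, h⟩
  simp only [this]

lemma smirnov_succ {n k : ℕ} (w : Fin (n + 1) → Fin k) :
    IsSmirnov w ↔ ∀ i : Fin n, w i.succ ≠ w i.castSucc := by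
  constructor
  · intro h i
    exact h i.castSucc (by simp)
  · intro h i hi
    exact h ⟨i, by omega⟩

lemma prod_Mt {n k : ℕ} (w : Fin (n + 1) → Fin k) (A : Type*) [CommRing A] (T : A)
    (x : Fin k → A) :
    x (w 0) * ∏ i : Fin n, Mt 1 T x (w i.castSucc) (w i.succ) =
      if IsSmirnov w then T ^ desc w * ∏ i, x (w i) else 0 := by
  split_ifs with h
  · rw [smirnov_succ] at h
    rw [desc_succ, ← Finset.prod_pow_eq_pow_sum, Fin.prod_univ_succ, mul_left_comm,
      ← Finset.prod_mul_distrib]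
    congr 1
    refine Finset.prod_congr rfl fun i _ => ?_
    simp only [Mt, Matrix.of_apply, if_neg (h i).symm]
    rcases lt_or_gt_of_ne (h i) with h1 | h1
    · simp [h1, h1.not_gt]
    · simp [h1, h1.not_gt]
  · rw [smirnov_succ] at h
    push Not at h
    obtain ⟨i, hi⟩ := h
    rw [Finset.prod_eq_zero (Finset.mem_univ i), mul_zero]
    simp [Mt, hi]

lemma enum_eq (n k : ℕ) (α β : ℕ) (P : (Fin (n + 1) → Fin k) → Prop)
    (hP : ∀ w, (if P w then (1 : ℕ) else 0) = if w (Fin.last n) = w 0 then 0 else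
      if w (Fin.last n) < w 0 then α else β) :
    smirnovEnum ℤ (n + 1) k desc P =
      PowerSeries.coeff (n + 1) (Vs (Mt 1 Polynomial.X
        (fun j => Polynomial.C (MvPolynomial.X j : MvPolynomial (Fin k) ℤ)))
        (Mt (α : Polynomial (MvPolynomial (Fin k) ℤ)) (β : Polynomial (MvPolynomial (Fin k) ℤ))
        (fun j => Polynomial.C (MvPolynomial.X j : MvPolynomial (Fin k) ℤ)))) := by
  rw [coeff_Vs]
  set x : Fin k → Polynomial (MvPolynomial (Fin k) ℤ) :=
    fun j => Polynomial.C (MvPolynomial.X j : MvPolynomial (Fin k) ℤ) with hx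
  set M := Mt 1 Polynomial.X x with hM
  have h1 : (M ^ n * Mt (α : Polynomial (MvPolynomial (Fin k) ℤ))
      (β : Polynomial (MvPolynomial (Fin k) ℤ)) x).trace =
      ∑ a, ∑ b, (Mt (α : Polynomial (MvPolynomial (Fin k) ℤ))
      (β : Polynomial (MvPolynomial (Fin k) ℤ)) x) b a * (M ^ n) a b := by
    simp only [Matrix.trace, Matrix.diag_apply, Matrix.mul_apply, mul_comm]
  rw [h1, ← word_sum M n (fun a b => (Mt (α : Polynomial (MvPolynomial (Fin k) ℤ))
      (β : Polynomial (MvPolynomial (Fin k) ℤ)) x) b a)]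
  rw [smirnovEnum, Finset.sum_filter]
  refine Finset.sum_congr rfl fun w _ => ?_
  have h2 : (Mt (α : Polynomial (MvPolynomial (Fin k) ℤ))
      (β : Polynomial (MvPolynomial (Fin k) ℤ)) x) (w (Fin.last n)) (w 0) =
      ((if P w then (1 : ℕ) else 0 : ℕ) : Polynomial (MvPolynomial (Fin k) ℤ)) * x (w 0) := by
    rw [hP]
    simp only [Mt, Matrix.of_apply]
    split_ifs <;> simp
  rw [h2, mul_assoc, prod_Mt]
  have h3 : Polynomial.C (xw ℤ w) = ∏ i, x (w i) := by
    simp [xw, hx, map_prod]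
  rw [h3]
  by_cases hS : IsSmirnov w <;> by_cases hp : P w <;> simp [hS, hp]

/-- the semiring generated by `t` and the elementary symmetric polynomials -/
def SE (k : ℕ) : Subsemiring (Polynomial (MvPolynomial (Fin k) ℤ)) :=
  Subsemiring.closure ({Polynomial.X} ∪
    Set.range fun i : ℕ => Polynomial.C (esymm (Fin k) ℤ (i + 1)))

lemma SE_symm {k : ℕ} {P : Polynomial (MvPolynomial (Fin k) ℤ)} (h : P ∈ SE k) : SymmX ℤ P := by
  have key : ∀ σ : Equiv.Perm (Fin k),
      SE k ≤ RingHom.eqLocusS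
        (Polynomial.mapRingHom (MvPolynomial.rename (R := ℤ) σ : _ →ₐ[ℤ] _).toRingHom)
        (RingHom.id _) := by
    intro σ
    refine Subsemiring.closure_le.2 ?_
    rintro p (rfl | ⟨i, rfl⟩)
    · show Polynomial.map _ _ = _
      simp
    · show Polynomial.map _ _ = _
      rw [Polynomial.map_C]
      exact congrArg Polynomial.C (MvPolynomial.esymm_isSymmetric (Fin k) ℤ (i + 1) σ)
  intro j σ
  have := congrArg (fun p => Polynomial.coeff p j) (key σ h)
  simpa using this

lemma EPosT_add {k : ℕ} {P Q : Polynomial (MvPolynomial (Fin k) ℤ)} (hP : EPosT ℤ P)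
    (hQ : EPosT ℤ Q) : EPosT ℤ (P + Q) := by
  obtain ⟨S, c, h1, h2, h3⟩ := hP
  obtain ⟨S', c', h1', h2', h3'⟩ := hQ
  refine ⟨S ∪ S', fun μ => (if μ ∈ S then c μ else 0) + (if μ ∈ S' then c' μ else 0), ?_, ?_, ?_⟩
  · intro μ hμ
    rcases Finset.mem_union.1 hμ with h | h
    · exact h1 μ h
    · exact h1' μ h
  · intro μ _ j
    rw [Polynomial.coeff_add]
    refine add_nonneg ?_ ?_
    · split_ifs with h
      · exact h2 μ h j
      · simp
    · split_ifs with h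
      · exact h2' μ h j
      · simp
  · simp only [Polynomial.map_add, add_mul, Finset.sum_add_distrib]
    rw [h3, h3']
    congr 1
    · rw [← Finset.sum_subset (Finset.subset_union_left : S ⊆ S ∪ S')]
      · exact Finset.sum_congr rfl fun μ hμ => by rw [if_pos hμ]
      · intro μ _ hμ
        simp [hμ]
    · rw [← Finset.sum_subset (Finset.subset_union_right : S' ⊆ S ∪ S')]
      · exact Finset.sum_congr rfl fun μ hμ => by rw [if_pos hμ]
      · intro μ _ hμ
        simp [hμ]

lemma SE_EPosT {k : ℕ} {P : Polynomial (MvPolynomial (Fin k) ℤ)} (h : P ∈ SE k) : EPosT ℤ P := by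
  rw [SE, Subsemiring.mem_closure_iff] at h
  have key : ∀ p ∈ Submonoid.closure ({Polynomial.X} ∪
      Set.range fun i : ℕ => Polynomial.C (esymm (Fin k) ℤ (i + 1))),
      ∃ (j : ℕ) (μ : Multiset ℕ), (∀ i ∈ μ, 0 < i) ∧
        p = Polynomial.X ^ j * Polynomial.C ((μ.map (esymm (Fin k) ℤ)).prod) := by
    intro p hp
    induction hp using Submonoid.closure_induction with
    | mem p hp =>
      rcases hp with rfl | ⟨i, rfl⟩
      · exact ⟨1, 0, by simp, by simp⟩
      · exact ⟨0, {i + 1}, by simp, by simp⟩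
    | one => exact ⟨0, 0, by simp, by simp⟩
    | mul p q _ _ ihp ihq =>
      obtain ⟨j, μ, hμ, rfl⟩ := ihp
      obtain ⟨j', μ', hμ', rfl⟩ := ihq
      refine ⟨j + j', μ + μ', ?_, ?_⟩
      · intro i hi
        rcases Multiset.mem_add.1 hi with h | h
        · exact hμ i h
        · exact hμ' i h
      · rw [Multiset.map_add, Multiset.prod_add, map_mul, pow_add]
        ring
  induction h using AddSubmonoid.closure_induction with
  | mem p hp =>
    obtain ⟨j, μ, hμ, rfl⟩ := key p hp
    refine ⟨{μ}, fun _ => Polynomial.X ^ j, by simpa using hμ, ?_, by simp⟩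
    intro _ _ i
    rw [Polynomial.coeff_X_pow]
    split_ifs <;> simp
  | zero => exact ⟨∅, 0, by simp, by simp, by simp⟩
  | add p q _ _ ihp ihq => exact EPosT_add ihp ihq

lemma enum_mem (n k : ℕ) (α β : ℕ) (P : (Fin (n + 1) → Fin k) → Prop)
    (hP : ∀ w, (if P w then (1 : ℕ) else 0) = if w (Fin.last n) = w 0 then 0 else
      if w (Fin.last n) < w 0 then α else β) :
    smirnovEnum ℤ (n + 1) k desc P ∈ SE k := by
  rw [enum_eq n k α β P hP]
  refine Vs_mem _ _ _ _ ?_ _ ?_ (natCast_mem _ _) (natCast_mem _ _) ?_ _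
  · intro h
    have := congrArg (fun p => Polynomial.coeff p 1) h
    simp [Polynomial.coeff_one] at this
  · exact Subsemiring.subset_closure (Or.inl rfl)
  · intro i
    refine Subsemiring.subset_closure (Or.inr ⟨i, ?_⟩)
    simp [El, esymm, map_sum, map_prod]

/-- For `n, k ≥ 1`, `W_n^<(x,t)` and `W_n^>(x,t)` are symmetric in
`x₁,…,x_k` and e-positive. -/
theorem smirnov_lt_gt_symmetric_ePositive (n k : ℕ) (hn : 1 ≤ n) (hk : 1 ≤ k) :
    (SymmX ℤ (smirnovEnum ℤ n k desc FirstLtLast) ∧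
      EPosT ℤ (smirnovEnum ℤ n k desc FirstLtLast)) ∧
    (SymmX ℤ (smirnovEnum ℤ n k desc FirstGtLast) ∧
      EPosT ℤ (smirnovEnum ℤ n k desc FirstGtLast)) := by
  obtain ⟨m, rfl⟩ : ∃ m, n = m + 1 := ⟨n - 1, by omega⟩
  have h1 : smirnovEnum ℤ (m + 1) k desc FirstLtLast ∈ SE k := by
    refine enum_mem m k 0 1 _ fun w => ?_
    have : FirstLtLast w ↔ w 0 < w (Fin.last m) := ⟨fun ⟨_, h⟩ => h, fun h => ⟨by omega, h⟩⟩
    simp only [this]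
    rcases lt_trichotomy (w 0) (w (Fin.last m)) with h | h | h
    · simp [h, h.not_gt, h.ne']
    · simp [h]
    · simp [h, h.not_gt]
  have h2 : smirnovEnum ℤ (m + 1) k desc FirstGtLast ∈ SE k := by
    refine enum_mem m k 1 0 _ fun w => ?_
    have : FirstGtLast w ↔ w (Fin.last m) < w 0 := ⟨fun ⟨_, h⟩ => h, fun h => ⟨by omega, h⟩⟩
    simp only [this]
    rcases lt_trichotomy (w 0) (w (Fin.last m)) with h | h | h
    · simp [h.not_gt]
    · simp [h]
    · simp [h, h.ne]
  exact ⟨⟨SE_symm h1, SE_EPosT h1⟩, ⟨SE_symm h2, SE_EPosT h2⟩⟩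

end
end
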